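/- arXiv:math/0312237 — 2 statements merged into one kernel-verified Lean document; each statement's English description precedes it below -/
import Mathlib

section
/- Let (W, S) be a Coxeter system, (Q, φ) a maximal partial special matching with a = φ(e), and X, Y ⊆ S such that: for every x ∈ X \ {a} the restriction of φ to P_x = ⟨x,a⟩ equals right multiplication by a, and for every y ∈ Y \ {a} the restriction of φ to P_y is a-regular on the left. Then ⟨X⟩(⟨Y⟩ ∩ Q) ⊆ Q, and φ(xy) = x·φ(y) for all x ∈ ⟨X⟩ and y ∈ ⟨Y⟩ ∩ Q. -/
open CoxeterSystem Polynomial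

section CoxPre

variable {B : Type*} {W : Type*} [Group W] {M : CoxeterMatrix B}

/-- The alternating word of length `n` starting with the letter `i`
(and then alternating between `i` and `j`). -/
def altW (i j : B) : ℕ → List B
  | 0 => []
  | n + 1 => i :: altW j i n

variable (cs : CoxeterSystem M W)

/-- The Bruhat order on a Coxeter group: the reflexive-transitive closure of the
relation `u → u * t` (`t` a reflection) when the length goes up. -/
def bruhatLE : W → W → Prop :=
  Relation.ReflTransGen
    (fun u v => ∃ t, cs.IsReflection t ∧ v = u * t ∧ cs.length u < cs.length v)

/-- The covering relation of the Bruhat order. -/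
def bCov (u v : W) : Prop :=
  bruhatLE cs u v ∧ u ≠ v ∧ ∀ z, bruhatLE cs u z → bruhatLE cs z v → z = u ∨ z = v

/-- The set of coatoms of `v` in the Bruhat order. -/
def bCoat (v : W) : Set W := {x | bCov cs x v}

/-- A partial special matching of `W` equipped with the Bruhat order: a Bruhat order
ideal `dom` together with an involution of it such that `u ⋖ φ u` or `φ u ⋖ u` for all
`u ∈ dom`, satisfying the coatom condition. -/
structure BSM where
  dom : Set W
  toFun : W → W
  ideal : ∀ ⦃x y : W⦄, y ∈ dom → bruhatLE cs x y → x ∈ dom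
  maps : ∀ x ∈ dom, toFun x ∈ dom
  invol : ∀ x ∈ dom, toFun (toFun x) = x
  cov : ∀ x ∈ dom, bCov cs (toFun x) x ∨ bCov cs x (toFun x)
  coatom : ∀ u ∈ dom, bCov cs u (toFun u) →
    bCoat cs (toFun u) =
      {u} ∪ {w | ∃ v, bCov cs v u ∧ bCov cs v (toFun v) ∧ w = toFun v}

/-- The standard dihedral subgroup `⟨s,t⟩` of `W`, as a set. -/
def dihedral (s t : B) : Set W :=
  (Subgroup.closure {cs.simple s, cs.simple t} : Subgroup W)

/-- `w` is full with respect to `J ⊆ S`: for all distinct `i, j ∈ J`, `m i j < ∞` and the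
longest element of `⟨i,j⟩` is `≤ w` in Bruhat order. -/
def IsFullWrt (J : Set B) (w : W) : Prop :=
  ∀ i ∈ J, ∀ j ∈ J, i ≠ j →
    M i j ≠ 0 ∧ bruhatLE cs (cs.wordProd (altW i j (M i j))) w

/-- The standard axioms characterizing the `R`-polynomials of the Hecke algebra of `W`. -/
def RAxioms (R : W → W → Polynomial ℤ) : Prop :=
  (∀ u, R u u = 1) ∧
  (∀ u v, ¬ bruhatLE cs u v → R u v = 0) ∧
  (∀ (i : B) (x y : W),
      cs.length (cs.simple i * x) = cs.length x + 1 →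
      cs.length (cs.simple i * y) = cs.length y + 1 →
      R (cs.simple i * x) (cs.simple i * y) = R x y ∧
      R x (cs.simple i * y) = (X - 1) * R x y + X * R (cs.simple i * x) y) ∧
  (∀ (i : B) (x y : W),
      cs.length (x * cs.simple i) = cs.length x + 1 →
      cs.length (y * cs.simple i) = cs.length y + 1 →
      R (x * cs.simple i) (y * cs.simple i) = R x y ∧
      R x (y * cs.simple i) = (X - 1) * R x y + X * R (x * cs.simple i) y)

variable {cs}

/-- `ψ` extends the partial special matching `φ`. -/
def BExtends (ψ φ : BSM cs) : Prop :=
  φ.dom ⊆ ψ.dom ∧ ∀ x ∈ φ.dom, ψ.toFun x = φ.toFun x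

/-- `φ` is a maximal partial special matching. -/
def BMax (φ : BSM cs) : Prop := ∀ ψ : BSM cs, BExtends ψ φ → ψ.dom = φ.dom

/-- `φ` is `g`-regular on the left: its domain is stable under left multiplication by `g`
and `φ` commutes with left multiplication by `g`. -/
def LeftReg (φ : BSM cs) (g : W) : Prop :=
  (∀ x ∈ φ.dom, g * x ∈ φ.dom) ∧ ∀ x ∈ φ.dom, φ.toFun (g * x) = g * φ.toFun x

/-- `φ` is `g`-regular on the right. -/
def RightReg (φ : BSM cs) (g : W) : Prop :=
  (∀ x ∈ φ.dom, x * g ∈ φ.dom) ∧ ∀ x ∈ φ.dom, φ.toFun (x * g) = φ.toFun x * g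

end CoxPre

namespace CoxeterBruhat

variable {B : Type*} {W : Type*} [Group W] {M : CoxeterMatrix B} (cs : CoxeterSystem M W)

/-! ### The strong exchange property -/

open Classical in
/-- The action of a simple reflection on `W × ℤ/2` which conjugates the first component and
flips the sign of the simple reflection itself. -/
noncomputable def signedConj (i : B) : Function.End (W × ZMod 2) :=
  fun p => (cs.simple i * p.1 * cs.simple i, p.2 + if p.1 = cs.simple i then 1 else 0)

theorem simple_mul_rotation_pow (i j : B) (n : ℕ) :
    cs.simple j * (cs.simple i * cs.simple j) ^ n =
      ((cs.simple i * cs.simple j) ^ n)⁻¹ * cs.simple j := by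
  induction n with
  | zero => simp
  | succ n ih =>
    rw [pow_succ, ← mul_assoc, ih, ← pow_succ, pow_succ']
    simp [mul_assoc]

open Classical in
theorem signedConj_mul_pow (i j : B) (k : ℕ) (t : W) (e : ZMod 2) :
    ((signedConj cs i * signedConj cs j) ^ k) (t, e) =
      ((cs.simple i * cs.simple j) ^ k * t * ((cs.simple i * cs.simple j) ^ k)⁻¹,
        e + ∑ n ∈ Finset.range (2 * k),
          if t = cs.simple j * (cs.simple i * cs.simple j) ^ n then 1 else 0) := by
  induction k with
  | zero => simp; rfl
  | succ k ih =>
    have hstep : ((signedConj cs i * signedConj cs j) ^ (k + 1)) (t, e) =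
        signedConj cs i (signedConj cs j
          (((signedConj cs i * signedConj cs j) ^ k) (t, e))) := by
      rw [pow_succ']; rfl
    rw [hstep, ih]
    set g := cs.simple i * cs.simple j with hg
    have hj : cs.simple j * cs.simple j = 1 := cs.simple_mul_simple_self j
    have h1 : g ^ k * t * (g ^ k)⁻¹ = cs.simple j ↔ t = cs.simple j * g ^ (2 * k) := by
      rw [two_mul, pow_add, ← mul_assoc, simple_mul_rotation_pow, mul_inv_eq_iff_eq_mul,
        ← eq_inv_mul_iff_mul_eq, mul_assoc]
    have h2 : cs.simple j * (g ^ k * t * (g ^ k)⁻¹) * cs.simple j = cs.simple i ↔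
        t = cs.simple j * g ^ (2 * k + 1) := by
      have e1 : cs.simple j * g ^ (2 * k + 1) =
          (g ^ k)⁻¹ * (cs.simple j * cs.simple i * cs.simple j) * g ^ k := by
        rw [show 2 * k + 1 = k + (1 + k) by ring, pow_add, ← mul_assoc,
          simple_mul_rotation_pow, pow_add, pow_one]
        simp [mul_assoc, hg]
      rw [e1]
      constructor
      · intro h
        rw [← h]
        simp [mul_assoc]
      · rintro rfl
        simp [mul_assoc]
    rw [show 2 * (k + 1) = 2 * k + 1 + 1 by ring, Finset.sum_range_succ, Finset.sum_range_succ]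
    simp only [signedConj, h1, h2, Prod.mk.injEq]
    refine ⟨?_, by ring⟩
    rw [pow_succ']
    simp [hg, mul_assoc]

theorem signedConj_isLiftable : M.IsLiftable (signedConj cs) := by
  classical
  intro i j
  funext ⟨t, e⟩
  rw [signedConj_mul_pow, cs.simple_mul_simple_pow, two_mul, Finset.sum_range_add]
  simp only [pow_add, cs.simple_mul_simple_pow, one_mul, CharTwo.add_self_eq_zero]
  simp
  rfl

/-- The action of `W` on `W × ℤ/2` extending `signedConj`. -/
noncomputable def signedConjHom : W →* Function.End (W × ZMod 2) :=
  cs.lift ⟨signedConj cs, signedConj_isLiftable cs⟩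

theorem signedConjHom_simple (i : B) : signedConjHom cs (cs.simple i) = signedConj cs i :=
  cs.lift_apply_simple (signedConj_isLiftable cs) i

open Classical in
theorem signedConjHom_wordProd (l : List B) (t : W) (e : ZMod 2) :
    signedConjHom cs (cs.wordProd l) (t, e) =
      (cs.wordProd l * t * (cs.wordProd l)⁻¹, e + ((cs.rightInvSeq l).count t : ZMod 2)) := by
  induction l with
  | nil => simp; rfl
  | cons i l ih =>
    have hstep : signedConjHom cs (cs.wordProd (i :: l)) (t, e) =
        signedConj cs i (signedConjHom cs (cs.wordProd l) (t, e)) := by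
      rw [cs.wordProd_cons, map_mul, signedConjHom_simple]; rfl
    have h : cs.wordProd l * t * (cs.wordProd l)⁻¹ = cs.simple i ↔
        (cs.wordProd l)⁻¹ * cs.simple i * cs.wordProd l = t := by
      constructor <;> rintro h
      · rw [← h]; simp [mul_assoc]
      · rw [← h]; simp [mul_assoc]
    rw [hstep, ih]
    simp only [signedConj, h, CoxeterSystem.rightInvSeq, List.count_cons, beq_iff_eq,
      Prod.mk.injEq, cs.wordProd_cons]
    refine ⟨by simp [mul_assoc], ?_⟩
    push_cast
    ring

theorem signedConjHom_mul (u v : W) (p : W × ZMod 2) :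
    signedConjHom cs (u * v) p = signedConjHom cs u (signedConjHom cs v p) := by
  rw [map_mul]; rfl

theorem signedConjHom_shift (w t : W) (e : ZMod 2) :
    signedConjHom cs w (t, e) = ((signedConjHom cs w (t, 0)).1, e + (signedConjHom cs w (t, 0)).2) := by
  obtain ⟨l, rfl⟩ := cs.wordProd_surjective w
  simp [signedConjHom_wordProd]

theorem signedConjHom_fst (w t : W) (e : ZMod 2) :
    (signedConjHom cs w (t, e)).1 = w * t * w⁻¹ := by
  obtain ⟨l, rfl⟩ := cs.wordProd_surjective w
  simp [signedConjHom_wordProd]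

theorem signedConjHom_reflection {t : W} (ht : cs.IsReflection t) :
    signedConjHom cs t (t, 0) = (t, 1) := by
  obtain ⟨w, i, rfl⟩ := ht
  set t := w * cs.simple i * w⁻¹ with ht
  set p := signedConjHom cs w⁻¹ (t, 0) with hp
  have hp1 : p.1 = cs.simple i := by
    rw [hp, signedConjHom_fst, ht]; simp [mul_assoc]
  have hback : signedConjHom cs w p = (t, 0) := by
    rw [hp, ← signedConjHom_mul, mul_inv_cancel, map_one]; rfl
  have hs : signedConjHom cs (cs.simple i) p = (p.1, 1 + p.2) := by
    rw [signedConjHom_simple]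
    simp [signedConj, hp1, add_comm]
  rw [ht, signedConjHom_mul, signedConjHom_mul, ← ht, ← hp, hs]
  have h3 := signedConjHom_shift cs w p.1 p.2
  have h4 := signedConjHom_shift cs w p.1 (1 + p.2)
  rw [Prod.mk.eta, hback] at h3
  rw [h4]
  rw [Prod.mk.injEq] at h3
  rw [Prod.mk.injEq, add_assoc, ← h3.2]
  exact ⟨h3.1.symm, by simp⟩

theorem mem_rightInvSeq_of_length_lt {l : List B} {t : W} (ht : cs.IsReflection t)
    (hlt : cs.length (cs.wordProd l * t) < cs.length (cs.wordProd l)) :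
    t ∈ cs.rightInvSeq l := by
  classical
  by_contra hmem
  have h0 : signedConjHom cs (cs.wordProd l) (t, 0) =
      (cs.wordProd l * t * (cs.wordProd l)⁻¹, 0) := by
    rw [signedConjHom_wordProd, List.count_eq_zero_of_not_mem hmem]; simp
  obtain ⟨l', hl', hw⟩ := cs.exists_isReduced (cs.wordProd l * t)
  have h1 : (signedConjHom cs (cs.wordProd l * t) (t, 0)).2 = 1 := by
    rw [signedConjHom_mul, signedConjHom_reflection cs ht, signedConjHom_shift, h0]; simp
  have hmem' : t ∈ cs.rightInvSeq l' := by
    by_contra hn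
    rw [hw, signedConjHom_wordProd, List.count_eq_zero_of_not_mem hn] at h1
    simp at h1
  have h2 := (cs.isRightInversion_of_mem_rightInvSeq hl' hmem').2
  rw [← hw, mul_assoc, ht.mul_self, mul_one] at h2
  omega

/-- The strong exchange property. -/
theorem exists_eraseIdx {l : List B} {t : W} (ht : cs.IsReflection t)
    (hlt : cs.length (cs.wordProd l * t) < cs.length (cs.wordProd l)) :
    ∃ j < l.length, cs.wordProd l * t = cs.wordProd (l.eraseIdx j) := by
  obtain ⟨j, hj, rfl⟩ := List.mem_iff_getElem.mp (mem_rightInvSeq_of_length_lt cs ht hlt)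
  refine ⟨j, by simpa using hj, ?_⟩
  rw [← List.getD_eq_getElem _ 1 hj, cs.wordProd_mul_getD_rightInvSeq]

/-! ### The Bruhat order -/

variable {cs}

theorem bruhatLE_refl (u : W) : bruhatLE cs u u := Relation.ReflTransGen.refl

theorem bruhatLE_trans {u v w : W} (h : bruhatLE cs u v) (h' : bruhatLE cs v w) :
    bruhatLE cs u w := Relation.ReflTransGen.trans h h'

theorem length_le_of_bruhatLE {u v : W} (h : bruhatLE cs u v) : cs.length u ≤ cs.length v := by
  induction h with
  | refl => exact le_rfl
  | tail _ h ih => obtain ⟨t, _, _, h⟩ := h; omega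

theorem eq_of_bruhatLE_of_length_le {u v : W} (h : bruhatLE cs u v)
    (hl : cs.length v ≤ cs.length u) : u = v := by
  rcases Relation.ReflTransGen.cases_tail h with h | ⟨w, hw, t, _, _, hlt⟩
  · exact h.symm
  · have := length_le_of_bruhatLE hw
    omega

theorem bruhatLE_mul_reflection {u t : W} (ht : cs.IsReflection t)
    (h : cs.length u < cs.length (u * t)) : bruhatLE cs u (u * t) :=
  Relation.ReflTransGen.single ⟨t, ht, rfl, h⟩

theorem bruhatLE_simple_mul {w : W} {i : B} (h : cs.length w < cs.length (cs.simple i * w)) :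
    bruhatLE cs w (cs.simple i * w) := by
  have ht : cs.IsReflection (w⁻¹ * cs.simple i * w) := by
    simpa using (cs.isReflection_simple i).conj w⁻¹
  have e : w * (w⁻¹ * cs.simple i * w) = cs.simple i * w := by simp [mul_assoc]
  rw [← e] at h ⊢
  exact bruhatLE_mul_reflection ht h

theorem simple_mul_bruhatLE {w : W} {i : B} (h : cs.length (cs.simple i * w) < cs.length w) :
    bruhatLE cs (cs.simple i * w) w := by
  have := bruhatLE_simple_mul (cs := cs) (w := cs.simple i * w) (i := i) (by simpa using h)
  simpa using this

theorem mul_simple_bruhatLE {w : W} {i : B} (h : cs.length (w * cs.simple i) < cs.length w) :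
    bruhatLE cs (w * cs.simple i) w := by
  have := bruhatLE_mul_reflection (cs := cs) (u := w * cs.simple i)
    (cs.isReflection_simple i) (by simpa using h)
  simpa using this

/-- Elements below `π l` are products of subwords of `l`. -/
theorem exists_sublist_of_bruhatLE {u : W} {l : List B} (h : bruhatLE cs u (cs.wordProd l)) :
    ∃ l', l'.Sublist l ∧ cs.wordProd l' = u := by
  generalize hv : cs.wordProd l = v at h
  induction h generalizing l with
  | refl => exact ⟨l, List.Sublist.refl l, hv⟩
  | @tail b c _ h ih =>
    obtain ⟨t, ht, rfl, hlt⟩ := h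
    have e : cs.wordProd l * t = b := by rw [hv, mul_assoc, ht.mul_self, mul_one]
    obtain ⟨j, -, hj⟩ := exists_eraseIdx cs ht (l := l) (by rw [e, hv]; exact hlt)
    obtain ⟨l', hl', hu⟩ := ih (hj.symm.trans e)
    exact ⟨l', hl'.trans (List.eraseIdx_sublist l j), hu⟩

theorem exists_reduced_sublist (l : List B) :
    ∃ l', l'.Sublist l ∧ cs.IsReduced l' ∧ cs.wordProd l' = cs.wordProd l := by
  induction l with
  | nil => exact ⟨[], List.Sublist.refl _, by simp [CoxeterSystem.IsReduced], rfl⟩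
  | cons i l ih =>
    obtain ⟨l', hs, hr, hp⟩ := ih
    have hr' : cs.length (cs.wordProd l') = l'.length := hr
    rcases cs.length_simple_mul (cs.wordProd l') i with h | h
    · refine ⟨i :: l', hs.cons_cons i, ?_, by simp [cs.wordProd_cons, hp]⟩
      rw [CoxeterSystem.IsReduced, cs.wordProd_cons, h, hr', List.length_cons]
    · have hle := simple_mul_bruhatLE (cs := cs) (w := cs.wordProd l') (i := i) (by omega)
      obtain ⟨k, hk, hkp⟩ := exists_sublist_of_bruhatLE hle
      have ht : cs.IsReflection ((cs.wordProd l')⁻¹ * cs.simple i * cs.wordProd l') := by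
        simpa using (cs.isReflection_simple i).conj (cs.wordProd l')⁻¹
      have e : cs.wordProd l' * ((cs.wordProd l')⁻¹ * cs.simple i * cs.wordProd l') =
          cs.simple i * cs.wordProd l' := by simp [mul_assoc]
      obtain ⟨j, hj, hjp⟩ := exists_eraseIdx cs ht (l := l') (by rw [e]; omega)
      rw [e] at hjp
      refine ⟨l'.eraseIdx j, ((List.eraseIdx_sublist l' j).trans hs).cons i, ?_, ?_⟩
      · rw [CoxeterSystem.IsReduced, ← hjp]
        have := List.length_eraseIdx_add_one hj
        omega
      · rw [← hjp, hp, cs.wordProd_cons]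

/-- If `u → v` is an edge of the Bruhat graph, then so is `i u → i v`, unless `i u = v`. -/
theorem simple_mul_edge {u t : W} (ht : cs.IsReflection t)
    (h : cs.length u < cs.length (u * t)) (i : B) :
    cs.simple i * u = u * t ∨
      cs.length (cs.simple i * u) < cs.length (cs.simple i * (u * t)) := by
  by_contra! hcon
  obtain ⟨hne, hle⟩ := hcon
  have hne' : cs.length (cs.simple i * (u * t)) ≠ cs.length (cs.simple i * u) := by
    rw [← mul_assoc]; exact ht.length_mul_left_ne _
  obtain ⟨l, hl, hw⟩ := cs.exists_isReduced (cs.simple i * (u * t))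
  have hl' : cs.length (cs.wordProd l) = l.length := hl
  have h1 := cs.length_simple_mul u i
  have h2 := cs.length_simple_mul (u * t) i
  have e : cs.wordProd (i :: l) = u * t := by
    rw [cs.wordProd_cons, ← hw, cs.simple_mul_simple_cancel_left]
  have e' : cs.wordProd (i :: l) * t = u := by rw [e, mul_assoc, ht.mul_self, mul_one]
  obtain ⟨j, hj, hjp⟩ := exists_eraseIdx cs ht (l := i :: l) (by rw [e', e]; exact h)
  rw [e'] at hjp
  cases j with
  | zero =>
    apply hne
    rw [List.eraseIdx_cons_zero, ← hw] at hjp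
    nth_rw 1 [hjp]
    rw [cs.simple_mul_simple_cancel_left]
  | succ j =>
    have h3 : cs.simple i * u = cs.wordProd (l.eraseIdx j) := by
      rw [hjp, List.eraseIdx_cons_succ, cs.wordProd_cons, cs.simple_mul_simple_cancel_left]
    have h4 := cs.length_wordProd_le (l.eraseIdx j)
    have h5 := List.length_eraseIdx_add_one (l := l) (i := j) (by simpa using hj)
    rw [← h3] at h4
    rw [← hw] at hl'
    omega

variable (cs) in
/-- The longer one of `w` and `i w`. -/
noncomputable def raise (i : B) (w : W) : W :=
  if cs.length w < cs.length (cs.simple i * w) then cs.simple i * w else w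

variable (cs) in
/-- The shorter one of `w` and `i w`. -/
noncomputable def lower (i : B) (w : W) : W :=
  if cs.length w < cs.length (cs.simple i * w) then w else cs.simple i * w

theorem raise_lower_mono {u v : W} (h : bruhatLE cs u v) (i : B) :
    bruhatLE cs (raise cs i u) (raise cs i v) ∧ bruhatLE cs (lower cs i u) (lower cs i v) := by
  induction h with
  | refl => exact ⟨bruhatLE_refl _, bruhatLE_refl _⟩
  | @tail u v _ h ih =>
    obtain ⟨t, ht, rfl, hlt⟩ := h
    suffices bruhatLE cs (raise cs i u) (raise cs i (u * t)) ∧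
        bruhatLE cs (lower cs i u) (lower cs i (u * t)) from
      ⟨bruhatLE_trans ih.1 this.1, bruhatLE_trans ih.2 this.2⟩
    have huv := bruhatLE_mul_reflection ht hlt
    have h1 := cs.length_simple_mul u i
    have h2 := cs.length_simple_mul (u * t) i
    rcases simple_mul_edge ht hlt i with he | he
    · have hu : cs.length u < cs.length (cs.simple i * u) := by rw [he]; exact hlt
      have hv : ¬ cs.length (u * t) < cs.length (cs.simple i * (u * t)) := by
        rw [← he, cs.simple_mul_simple_cancel_left]; omega
      rw [raise, raise, lower, lower, if_pos hu, if_neg hv, if_pos hu, if_neg hv, ← he,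
        cs.simple_mul_simple_cancel_left]
      exact ⟨bruhatLE_refl _, bruhatLE_refl _⟩
    · have hsuv : bruhatLE cs (cs.simple i * u) (cs.simple i * (u * t)) := by
        rw [← mul_assoc] at he ⊢
        exact bruhatLE_mul_reflection ht he
      unfold raise lower
      split_ifs with hu hv hv
      · exact ⟨hsuv, huv⟩
      · exact ⟨bruhatLE_trans hsuv (simple_mul_bruhatLE (by omega)),
          bruhatLE_trans (bruhatLE_simple_mul hu) hsuv⟩
      · exact ⟨bruhatLE_trans huv (bruhatLE_simple_mul hv),
          bruhatLE_trans (simple_mul_bruhatLE (by omega)) huv⟩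
      · exact ⟨huv, hsuv⟩

theorem simple_mul_mono_of_lt {u v : W} {i : B} (h : bruhatLE cs u v)
    (hu : cs.length u < cs.length (cs.simple i * u))
    (hv : cs.length v < cs.length (cs.simple i * v)) :
    bruhatLE cs (cs.simple i * u) (cs.simple i * v) := by
  simpa [raise, hu, hv] using (raise_lower_mono h i).1

theorem simple_mul_mono_of_gt {u v : W} {i : B} (h : bruhatLE cs u v)
    (hu : cs.length (cs.simple i * u) < cs.length u)
    (hv : cs.length (cs.simple i * v) < cs.length v) :
    bruhatLE cs (cs.simple i * u) (cs.simple i * v) := by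
  simpa [lower, hu.not_gt, hv.not_gt] using (raise_lower_mono h i).2

theorem simple_mul_bruhatLE_of_lt_of_gt {u v : W} {i : B} (h : bruhatLE cs u v)
    (hu : cs.length u < cs.length (cs.simple i * u))
    (hv : cs.length (cs.simple i * v) < cs.length v) :
    bruhatLE cs (cs.simple i * u) v := by
  simpa [raise, hu, hv.not_gt] using (raise_lower_mono h i).1

theorem bruhatLE_simple_mul_of_lt_of_gt {u v : W} {i : B} (h : bruhatLE cs u v)
    (hu : cs.length u < cs.length (cs.simple i * u))
    (hv : cs.length (cs.simple i * v) < cs.length v) :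
    bruhatLE cs u (cs.simple i * v) := by
  simpa [lower, hu, hv.not_gt] using (raise_lower_mono h i).2

theorem exists_left_descent {w : W} (hw : w ≠ 1) :
    ∃ i, cs.length (cs.simple i * w) + 1 = cs.length w := by
  obtain ⟨i, hi⟩ := cs.exists_leftDescent_of_ne_one hw
  exact ⟨i, cs.isLeftDescent_iff.mp hi⟩

/-- The chain property: below `v`, every `u < v` is below an element of length one less. -/
theorem exists_bruhatLE_length_add_one {u v : W} (h : bruhatLE cs u v) (hne : u ≠ v) :
    ∃ v', bruhatLE cs u v' ∧ bruhatLE cs v' v ∧ cs.length v = cs.length v' + 1 := by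
  induction hn : cs.length v using Nat.strong_induction_on generalizing u v with
  | _ n ih =>
    have hlt : cs.length u < cs.length v := by
      by_contra hle
      exact hne (eq_of_bruhatLE_of_length_le h (by omega))
    have hv1 : v ≠ 1 := by
      rintro rfl
      simp at hlt
    obtain ⟨i, hi⟩ := exists_left_descent (cs := cs) hv1
    have hvv := simple_mul_bruhatLE (cs := cs) (w := v) (i := i) (by omega)
    rcases cs.length_simple_mul u i with hu | hu
    · exact ⟨cs.simple i * v, bruhatLE_simple_mul_of_lt_of_gt h (by omega) (by omega), hvv,
        by omega⟩
    · have hle := simple_mul_mono_of_gt h (i := i) (by omega) (by omega)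
      obtain ⟨v', h1, h2, h3⟩ := ih (cs.length (cs.simple i * v)) (by omega) hle
        (fun e => hne (mul_left_cancel e)) rfl
      rcases cs.length_simple_mul v' i with hv' | hv'
      · refine ⟨cs.simple i * v', ?_, ?_, by omega⟩
        · have := simple_mul_mono_of_lt h1 (i := i)
            (by rw [cs.simple_mul_simple_cancel_left]; omega) (by omega)
          rwa [cs.simple_mul_simple_cancel_left] at this
        · exact simple_mul_bruhatLE_of_lt_of_gt (bruhatLE_trans h2 hvv) (by omega) (by omega)
      · refine ⟨cs.simple i * v, ?_, hvv, by omega⟩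
        have := simple_mul_bruhatLE_of_lt_of_gt h1 (i := i)
            (by rw [cs.simple_mul_simple_cancel_left]; omega) (by omega)
        rw [cs.simple_mul_simple_cancel_left] at this
        exact bruhatLE_trans this h2

theorem bCov_iff {u v : W} :
    bCov cs u v ↔ bruhatLE cs u v ∧ cs.length v = cs.length u + 1 := by
  constructor
  · rintro ⟨h, hne, hz⟩
    obtain ⟨v', h1, h2, h3⟩ := exists_bruhatLE_length_add_one h hne
    rcases hz v' h1 h2 with rfl | rfl
    · exact ⟨h, h3⟩
    · omega
  · rintro ⟨h, hl⟩
    refine ⟨h, fun e => by rw [e] at hl; omega, fun z h1 h2 => ?_⟩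
    have l1 := length_le_of_bruhatLE h1
    have l2 := length_le_of_bruhatLE h2
    by_cases hz : cs.length z = cs.length u
    · exact Or.inl (eq_of_bruhatLE_of_length_le h1 hz.le).symm
    · exact Or.inr (eq_of_bruhatLE_of_length_le h2 (by omega))

theorem exists_bCov {u v : W} (h : bruhatLE cs u v) (hne : u ≠ v) :
    ∃ v', bruhatLE cs u v' ∧ bCov cs v' v := by
  obtain ⟨v', h1, h2, h3⟩ := exists_bruhatLE_length_add_one h hne
  exact ⟨v', h1, bCov_iff.2 ⟨h2, h3⟩⟩

theorem one_bruhatLE (w : W) : bruhatLE cs 1 w := by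
  induction hn : cs.length w using Nat.strong_induction_on generalizing w with
  | _ n ih =>
    by_cases hw : w = 1
    · rw [hw]; exact bruhatLE_refl 1
    · obtain ⟨i, hi⟩ := exists_left_descent (cs := cs) hw
      exact bruhatLE_trans (ih _ (by omega) (cs.simple i * w) rfl) (simple_mul_bruhatLE (by omega))

theorem simple_bruhatLE {w : W} {i : B} (h : cs.length (cs.simple i * w) < cs.length w) :
    bruhatLE cs (cs.simple i) w := by
  have := simple_mul_bruhatLE_of_lt_of_gt (one_bruhatLE (cs := cs) w) (i := i) (by simp) h
  simpa using this

/-! ### Standard parabolic subgroups -/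

variable (cs) in
/-- The standard parabolic subgroup generated by `K`. -/
abbrev parabolic (K : Set B) : Subgroup W := Subgroup.closure (cs.simple '' K)

theorem wordProd_mem_parabolic {K : Set B} {l : List B} (hl : ∀ i ∈ l, i ∈ K) :
    cs.wordProd l ∈ parabolic cs K := by
  induction l with
  | nil => simp
  | cons i l ih =>
    rw [cs.wordProd_cons]
    exact mul_mem (Subgroup.subset_closure ⟨i, hl i (by simp), rfl⟩)
      (ih fun k hk => hl k (by simp [hk]))

theorem exists_word_of_mem_parabolic {K : Set B} {w : W} (hw : w ∈ parabolic cs K) :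
    ∃ l : List B, (∀ i ∈ l, i ∈ K) ∧ cs.wordProd l = w := by
  induction hw using Subgroup.closure_induction with
  | mem x hx =>
    obtain ⟨i, hi, rfl⟩ := hx
    exact ⟨[i], by simpa using hi, by simp⟩
  | one => exact ⟨[], by simp, by simp⟩
  | mul x y _ _ hx hy =>
    obtain ⟨l, hl, rfl⟩ := hx
    obtain ⟨l', hl', rfl⟩ := hy
    refine ⟨l ++ l', fun i hi => ?_, cs.wordProd_append l l'⟩
    exact (List.mem_append.1 hi).elim (hl i) (hl' i)
  | inv x _ hx =>
    obtain ⟨l, hl, rfl⟩ := hx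
    exact ⟨l.reverse, fun i hi => hl i (List.mem_reverse.1 hi), cs.wordProd_reverse l⟩

theorem mem_parabolic_of_bruhatLE {K : Set B} {u v : W} (h : bruhatLE cs u v)
    (hv : v ∈ parabolic cs K) : u ∈ parabolic cs K := by
  obtain ⟨l, hl, rfl⟩ := exists_word_of_mem_parabolic hv
  obtain ⟨l', hs, rfl⟩ := exists_sublist_of_bruhatLE h
  exact wordProd_mem_parabolic fun i hi => hl i (hs.subset hi)

theorem simple_mem_parabolic {K : Set B} {i : B} (h : cs.simple i ∈ parabolic cs K) :
    ∃ k ∈ K, cs.simple i = cs.simple k := by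
  obtain ⟨l, hl, hp⟩ := exists_word_of_mem_parabolic h
  obtain ⟨l', hs, hr, hp'⟩ := exists_reduced_sublist (cs := cs) l
  have hlen : l'.length = 1 := by
    rw [← hr.eq, hp', hp, cs.length_simple]
  obtain ⟨k, rfl⟩ := List.length_eq_one_iff.1 hlen
  refine ⟨k, hl k (hs.subset (by simp)), ?_⟩
  rw [← hp, ← hp', cs.wordProd_singleton]

/-! ### Elements with the same coatoms -/

theorem length_eq_of_bCoat_eq {p q : W} (h : bCoat cs p = bCoat cs q) (hp : p ≠ 1) :
    cs.length p = cs.length q := by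
  obtain ⟨i, hi⟩ := exists_left_descent (cs := cs) hp
  have hmem : cs.simple i * p ∈ bCoat cs p :=
    bCov_iff.2 ⟨simple_mul_bruhatLE (by omega), by omega⟩
  rw [h] at hmem
  have := (bCov_iff.1 hmem).2
  omega

theorem eq_of_bCoat_eq_of_common_descent {p q : W} {i : B} (h : bCoat cs p = bCoat cs q)
    (hp : cs.length (cs.simple i * p) < cs.length p)
    (hq : cs.length (cs.simple i * q) < cs.length q) : p = q := by
  have h1 := cs.length_simple_mul p i
  have h2 := cs.length_simple_mul q i
  have hmem : cs.simple i * p ∈ bCoat cs p :=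
    bCov_iff.2 ⟨simple_mul_bruhatLE hp, by omega⟩
  rw [h] at hmem
  obtain ⟨h3, h4⟩ := bCov_iff.1 hmem
  have h5 := bruhatLE_simple_mul_of_lt_of_gt h3 (i := i)
    (by rwa [cs.simple_mul_simple_cancel_left]) hq
  exact mul_left_cancel (eq_of_bruhatLE_of_length_le h5 (by omega))

theorem mul_simple_eq_of_bCoat_eq {p q : W} {t r : B} (h : bCoat cs p = bCoat cs q)
    (hp : cs.length p < cs.length (cs.simple t * p))
    (hq : cs.length (cs.simple t * q) < cs.length q)
    (hr : cs.length (p * cs.simple r) < cs.length p) :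
    p * cs.simple r = cs.simple t * q := by
  have h1 := cs.length_mul_simple p r
  have h2 := cs.length_simple_mul q t
  have h3 := cs.length_simple_mul p t
  have hmem : p * cs.simple r ∈ bCoat cs p :=
    bCov_iff.2 ⟨mul_simple_bruhatLE hr, by omega⟩
  rw [h] at hmem
  obtain ⟨h4, h5⟩ := bCov_iff.1 hmem
  have h6 := cs.length_simple_mul (p * cs.simple r) t
  have h7 := cs.length_mul_simple (cs.simple t * p) r
  rw [mul_assoc] at h7
  exact eq_of_bruhatLE_of_length_le
    (bruhatLE_simple_mul_of_lt_of_gt h4 (i := t) (by omega) hq) (by omega)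

theorem mem_or_mem_of_bCoat_eq {p q : W} {s t : B} {J : Subgroup W}
    (h : bCoat cs p = bCoat cs q) (hl : cs.length p = cs.length q)
    (hs : cs.simple s ∈ J) (ht : cs.simple t ∈ J)
    (hsp : cs.length (cs.simple s * p) < cs.length p)
    (hsq : cs.length q < cs.length (cs.simple s * q))
    (htp : cs.length p < cs.length (cs.simple t * p))
    (htq : cs.length (cs.simple t * q) < cs.length q)
    {j m : W} (hj : j ∈ J) (hjm : p = j * m) (hlen : cs.length p = cs.length j + cs.length m) :
    p ∈ J ∨ q ∈ J := by
  induction hk : cs.length m generalizing p q s t j m with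
  | zero =>
    rw [cs.length_eq_zero_iff] at hk
    left
    rwa [hjm, hk, mul_one]
  | succ k ih =>
    have hm : m ≠ 1 := by
      rintro rfl
      simp at hk
    obtain ⟨r, hr⟩ := cs.exists_rightDescent_of_ne_one hm
    rw [cs.isRightDescent_iff] at hr
    have e : p * cs.simple r = j * (m * cs.simple r) := by rw [hjm, mul_assoc]
    have h1 := cs.length_mul_le j (m * cs.simple r)
    rw [← e] at h1
    have h2 := cs.length_mul_simple p r
    have h3 := mul_simple_eq_of_bCoat_eq h htp htq (r := r) (by omega)
    have h4 : q = (cs.simple t * j) * (m * cs.simple r) := by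
      rw [mul_assoc, ← e, h3, cs.simple_mul_simple_cancel_left]
    have h5 := cs.length_simple_mul j t
    have h6 := cs.length_mul_le (cs.simple t * j) (m * cs.simple r)
    rw [← h4] at h6
    exact (ih h.symm hl.symm ht hs htq htp hsq hsp (mul_mem ht hj) h4 (by omega)
      (by omega)).symm

theorem mem_of_bCoat_eq_of_mem {p q : W} {t : B} {K : Set B}
    (h : bCoat cs p = bCoat cs q) (ht : t ∈ K)
    (htq : cs.length (cs.simple t * q) + 1 = cs.length q)
    (hp : p ∈ parabolic cs K) : q ∈ parabolic cs K := by
  have hmem : cs.simple t * q ∈ bCoat cs q :=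
    bCov_iff.2 ⟨simple_mul_bruhatLE (by omega), by omega⟩
  rw [← h] at hmem
  have h1 := mem_parabolic_of_bruhatLE (bCov_iff.1 hmem).1 hp
  have h2 : cs.simple t ∈ parabolic cs K := Subgroup.subset_closure ⟨t, ht, rfl⟩
  have := mul_mem h2 h1
  rwa [cs.simple_mul_simple_cancel_left] at this

/-- Two distinct elements with the same coatoms lie in a common standard dihedral subgroup. -/
theorem exists_dihedral_of_bCoat_eq {p q : W} (h : bCoat cs p = bCoat cs q)
    (hp : p ≠ 1) (hq : q ≠ 1) (hne : p ≠ q) :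
    ∃ s t, p ∈ parabolic cs {s, t} ∧ q ∈ parabolic cs {s, t} := by
  obtain ⟨s, hs⟩ := exists_left_descent (cs := cs) hp
  obtain ⟨t, ht⟩ := exists_left_descent (cs := cs) hq
  have hsq := cs.length_simple_mul q s
  have htp := cs.length_simple_mul p t
  have hsq' : cs.length q < cs.length (cs.simple s * q) := by
    by_contra hc
    exact hne (eq_of_bCoat_eq_of_common_descent h (i := s) (by omega) (by omega))
  have htp' : cs.length p < cs.length (cs.simple t * p) := by
    by_contra hc
    exact hne (eq_of_bCoat_eq_of_common_descent h (i := t) (by omega) (by omega))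
  refine ⟨s, t, ?_⟩
  rcases mem_or_mem_of_bCoat_eq (J := parabolic cs {s, t}) h (length_eq_of_bCoat_eq h hp)
    (Subgroup.subset_closure ⟨s, by simp, rfl⟩) (Subgroup.subset_closure ⟨t, by simp, rfl⟩)
    (by omega) hsq' htp' (by omega) (one_mem _) (one_mul p).symm (by simp) with hm | hm
  · exact ⟨hm, mem_of_bCoat_eq_of_mem h (by simp) ht hm⟩
  · exact ⟨mem_of_bCoat_eq_of_mem h.symm (by simp) hs hm, hm⟩

/-! ### Partial special matchings -/

theorem length_toFun (φ : BSM cs) {w : W} (hw : w ∈ φ.dom) :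
    cs.length (φ.toFun w) = cs.length w + 1 ∨ cs.length (φ.toFun w) + 1 = cs.length w := by
  rcases φ.cov w hw with h | h
  · exact Or.inr (bCov_iff.1 h).2.symm
  · exact Or.inl (bCov_iff.1 h).2

theorem bCov_toFun (φ : BSM cs) {w : W} (hw : w ∈ φ.dom)
    (hl : cs.length (φ.toFun w) = cs.length w + 1) : bCov cs w (φ.toFun w) := by
  rcases φ.cov w hw with h | h
  · have := (bCov_iff.1 h).2
    omega
  · exact h

theorem toFun_bCov (φ : BSM cs) {w : W} (hw : w ∈ φ.dom)
    (hl : cs.length (φ.toFun w) + 1 = cs.length w) : bCov cs (φ.toFun w) w := by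
  rcases φ.cov w hw with h | h
  · exact h
  · have := (bCov_iff.1 h).2
    omega

theorem toFun_bCov_toFun (φ : BSM cs) {u v : W} (hu : u ∈ φ.dom) (huu : bCov cs u (φ.toFun u))
    (hvu : bCov cs v u) (hvv : bCov cs v (φ.toFun v)) :
    bCov cs (φ.toFun v) (φ.toFun u) := by
  have : φ.toFun v ∈ bCoat cs (φ.toFun u) := by
    rw [φ.coatom u hu huu]
    exact Or.inr ⟨v, hvu, hvv, rfl⟩
  exact this

/-- If `φ u` covers `u`, then `φ 1 ≤ φ u`. -/
theorem toFun_one_bruhatLE (φ : BSM cs) {u : W} (hu : u ∈ φ.dom)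
    (huu : bCov cs u (φ.toFun u)) : bruhatLE cs (φ.toFun 1) (φ.toFun u) := by
  induction hn : cs.length u using Nat.strong_induction_on generalizing u with
  | _ n ih =>
    by_cases hu1 : u = 1
    · rw [hu1]; exact bruhatLE_refl _
    · obtain ⟨i, hi⟩ := exists_left_descent (cs := cs) hu1
      have hvu : bruhatLE cs (cs.simple i * u) u := simple_mul_bruhatLE (by omega)
      have hv := φ.ideal hu hvu
      rcases length_toFun φ hv with hl | hl
      · have hvv := bCov_toFun φ hv hl
        exact bruhatLE_trans (ih _ (by omega) hv hvv rfl)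
          (toFun_bCov_toFun φ hu huu (bCov_iff.2 ⟨hvu, by omega⟩) hvv).1
      · have hcov := toFun_bCov φ hv hl
        have hinv := φ.invol _ hv
        have := ih _ (by omega) (φ.maps _ hv) (by rwa [hinv]) rfl
        rw [hinv] at this
        exact bruhatLE_trans this (bruhatLE_trans hvu huu.1)

open Classical in
/-- A maximal partial special matching cannot be extended by a single matched pair. -/
theorem mem_dom_of_bCoat_eq {φ : BSM cs} (hmax : BMax φ) {z z' : W} (hzz : bCov cs z z')
    (hlow : ∀ v, bCov cs v z → v ∈ φ.dom)
    (hcoat : bCoat cs z' = {z} ∪ {w | ∃ v, bCov cs v z ∧ bCov cs v (φ.toFun v) ∧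
      w = φ.toFun v}) : z ∈ φ.dom := by
  by_contra hz
  have hz' : z' ∉ φ.dom := fun h => hz (φ.ideal h hzz.1)
  set f : W → W := fun w => if w = z then z' else if w = z' then z else φ.toFun w with hf
  have hfz : f z = z' := by simp [hf]
  have hfz' : f z' = z := by simp [hf, hzz.2.1.symm]
  have hfd : ∀ w ∈ φ.dom, f w = φ.toFun w := fun w hw => by
    have h1 : w ≠ z := fun h => hz (h ▸ hw)
    have h2 : w ≠ z' := fun h => hz' (h ▸ hw)
    simp [hf, h1, h2]
  have hfset : ∀ u, (∀ v, bCov cs v u → v ∈ φ.dom) →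
      {w | ∃ v, bCov cs v u ∧ bCov cs v (φ.toFun v) ∧ w = φ.toFun v} =
        {w | ∃ v, bCov cs v u ∧ bCov cs v (f v) ∧ w = f v} := fun u hu => by
    ext w
    constructor
    · rintro ⟨v, h1, h2, h3⟩
      exact ⟨v, h1, by rwa [hfd v (hu v h1)], by rwa [hfd v (hu v h1)]⟩
    · rintro ⟨v, h1, h2, h3⟩
      rw [hfd v (hu v h1)] at h2 h3
      exact ⟨v, h1, h2, h3⟩
  have hbelow : ∀ x, bruhatLE cs x z → x ≠ z → x ∈ φ.dom := fun x hx hne => by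
    obtain ⟨v, h1, h2⟩ := exists_bCov hx hne
    exact φ.ideal (hlow v h2) h1
  let ψ : BSM cs :=
    { dom := φ.dom ∪ {z, z'}
      toFun := f
      ideal := by
        rintro x y (hy | rfl | rfl) hxy
        · exact Or.inl (φ.ideal hy hxy)
        · by_cases hx : x = y
          · simp [hx]
          · exact Or.inl (hbelow x hxy hx)
        · by_cases hx : x = y
          · simp [hx]
          · obtain ⟨v, h1, h2⟩ := exists_bCov hxy hx
            have h3 : v ∈ bCoat cs y := h2
            rw [hcoat] at h3
            rcases h3 with rfl | ⟨v', h4, -, rfl⟩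
            · by_cases hxv : x = v
              · simp [hxv]
              · exact Or.inl (hbelow x h1 hxv)
            · exact Or.inl (φ.ideal (φ.maps _ (hlow v' h4)) h1)
      maps := by
        rintro x (hx | rfl | rfl)
        · rw [hfd x hx]
          exact Or.inl (φ.maps x hx)
        · simp [hfz]
        · simp [hfz']
      invol := by
        rintro x (hx | rfl | rfl)
        · rw [hfd x hx, hfd _ (φ.maps x hx), φ.invol x hx]
        · rw [hfz, hfz']
        · rw [hfz', hfz]
      cov := by
        rintro x (hx | rfl | rfl)
        · rw [hfd x hx]
          exact φ.cov x hx
        · rw [hfz]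
          exact Or.inr hzz
        · rw [hfz']
          exact Or.inl hzz
      coatom := by
        rintro u (hu | rfl | rfl) huu
        · rw [hfd u hu] at huu ⊢
          rw [φ.coatom u hu huu, hfset u fun v hv => φ.ideal hu hv.1]
        · rw [hfz, hcoat, hfset u hlow]
        · rw [hfz'] at huu
          have h1 := (bCov_iff.1 huu).2
          have h2 := (bCov_iff.1 hzz).2
          omega }
  have hψ : ψ.dom = φ.dom := hmax ψ ⟨fun x hx => Or.inl hx, hfd⟩
  exact hz (hψ ▸ (Or.inr (Or.inl rfl) : z ∈ φ.dom ∪ {z, z'}))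

/-- The coatoms of `c (φ u)` when `c` is an ascent of `u` and `φ u`, and `φ` commutes with left
multiplication by `c` on shorter elements below `u`. -/
theorem bCoat_simple_mul_toFun {φ : BSM cs} {u : W} {c : B} (hu : u ∈ φ.dom)
    (huu : cs.length (φ.toFun u) = cs.length u + 1)
    (hcu : cs.length (cs.simple c * u) = cs.length u + 1)
    (hcφ : cs.length (cs.simple c * φ.toFun u) = cs.length (φ.toFun u) + 1)
    (hreg : ∀ v, bCov cs v u → cs.simple c * v ∈ φ.dom ∧
      φ.toFun (cs.simple c * v) = cs.simple c * φ.toFun v) :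
    bCoat cs (cs.simple c * φ.toFun u) = {cs.simple c * u} ∪
      {w | ∃ v, bCov cs v (cs.simple c * u) ∧ bCov cs v (φ.toFun v) ∧ w = φ.toFun v} := by
  have huc := bCov_toFun φ hu huu
  have hcc : ∀ w : W, cs.simple c * (cs.simple c * w) = w :=
    fun w => cs.simple_mul_simple_cancel_left c
  ext x
  constructor
  · intro hx
    obtain ⟨h1, h2⟩ := bCov_iff.1 hx
    rcases cs.length_simple_mul x c with hcx | hcx
    · have h3 := bruhatLE_simple_mul_of_lt_of_gt h1 (i := c) (by omega) (by rw [hcc]; omega)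
      rw [hcc] at h3
      have h4 := eq_of_bruhatLE_of_length_le h3 (by omega)
      exact Or.inr ⟨u, bCov_iff.2 ⟨bruhatLE_simple_mul (by omega), hcu⟩, huc, h4⟩
    · have h3 := simple_mul_mono_of_gt h1 (i := c) (by omega) (by rw [hcc]; omega)
      rw [hcc] at h3
      have h4 : cs.simple c * x ∈ bCoat cs (φ.toFun u) := bCov_iff.2 ⟨h3, by omega⟩
      rw [φ.coatom u hu huc] at h4
      rcases h4 with h4 | ⟨v, hvu, hvv, h4⟩
      · left
        rw [Set.mem_singleton_iff] at h4 ⊢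
        rw [← h4, hcc]
      · right
        obtain ⟨h5, h6⟩ := hreg v hvu
        have hx' : x = φ.toFun (cs.simple c * v) := by rw [h6, ← h4, hcc]
        have h7 := length_toFun φ h5
        have h8 := cs.length_simple_mul v c
        have h9 := (bCov_iff.1 hvu).2
        rw [← hx'] at h7
        refine ⟨cs.simple c * v, bCov_iff.2 ⟨simple_mul_mono_of_lt hvu.1 (by omega) (by omega),
          by omega⟩, ?_, hx'⟩
        exact bCov_toFun φ h5 (by rw [← hx']; omega)
  · rintro (hx | ⟨v, hvz, hvv, rfl⟩)
    · rw [Set.mem_singleton_iff] at hx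
      rw [hx]
      exact bCov_iff.2 ⟨simple_mul_mono_of_lt huc.1 (by omega) (by omega), by omega⟩
    · obtain ⟨h1, h2⟩ := bCov_iff.1 hvz
      rcases cs.length_simple_mul v c with hcv | hcv
      · have h3 := bruhatLE_simple_mul_of_lt_of_gt h1 (i := c) (by omega) (by rw [hcc]; omega)
        rw [hcc] at h3
        rw [eq_of_bruhatLE_of_length_le h3 (by omega)]
        exact bCov_iff.2 ⟨bruhatLE_simple_mul (by omega), by omega⟩
      · have h3 := simple_mul_mono_of_gt h1 (i := c) (by omega) (by rw [hcc]; omega)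
        rw [hcc] at h3
        have hvu : bCov cs (cs.simple c * v) u := bCov_iff.2 ⟨h3, by omega⟩
        obtain ⟨h5, h6⟩ := hreg _ hvu
        rw [hcc] at h5 h6
        have h7 := length_toFun φ (φ.ideal hu h3)
        have h8 := cs.length_simple_mul (φ.toFun (cs.simple c * v)) c
        rw [← h6] at h8
        have h9 := (bCov_iff.1 hvv).2
        have h10 := toFun_bCov_toFun φ hu huc hvu
          (bCov_toFun φ (φ.ideal hu h3) (by omega))
        have h11 := (bCov_iff.1 h10).2
        refine bCov_iff.2 ⟨?_, by omega⟩
        rw [h6]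
        exact simple_mul_mono_of_lt h10.1 (by rw [← h6]; omega) (by omega)

variable (cs) in
/-- The product `⟨X⟩⟨Y⟩` of two standard parabolic subgroups. -/
def parabolicProd (X Y : Set B) : Set W :=
  {w | ∃ l₁ l₂ : List B, (∀ i ∈ l₁, i ∈ X) ∧ (∀ i ∈ l₂, i ∈ Y) ∧ cs.wordProd (l₁ ++ l₂) = w}

theorem mul_mem_parabolicProd {X Y : Set B} {x y : W} (hx : x ∈ parabolic cs X)
    (hy : y ∈ parabolic cs Y) : x * y ∈ parabolicProd cs X Y := by
  obtain ⟨l₁, h₁, rfl⟩ := exists_word_of_mem_parabolic hx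
  obtain ⟨l₂, h₂, rfl⟩ := exists_word_of_mem_parabolic hy
  exact ⟨l₁, l₂, h₁, h₂, cs.wordProd_append l₁ l₂⟩

theorem mem_parabolicProd_of_bruhatLE {X Y : Set B} {u v : W} (h : bruhatLE cs u v)
    (hv : v ∈ parabolicProd cs X Y) : u ∈ parabolicProd cs X Y := by
  obtain ⟨l₁, l₂, h₁, h₂, rfl⟩ := hv
  obtain ⟨l, hs, rfl⟩ := exists_sublist_of_bruhatLE h
  obtain ⟨k₁, k₂, rfl, hk₁, hk₂⟩ := List.sublist_append_iff.1 hs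
  exact ⟨k₁, k₂, fun i hi => h₁ i (hk₁.subset hi), fun i hi => h₂ i (hk₂.subset hi), rfl⟩

theorem exists_left_descent_of_mem_parabolicProd {X Y : Set B} {u : W}
    (hu : u ∈ parabolicProd cs X Y) (hne : u ≠ 1) :
    ∃ i, (i ∈ X ∨ i ∈ Y) ∧ cs.length (cs.simple i * u) < cs.length u := by
  obtain ⟨l₁, l₂, h₁, h₂, rfl⟩ := hu
  obtain ⟨l, hs, hr, hp⟩ := exists_reduced_sublist (cs := cs) (l₁ ++ l₂)
  rw [← hp] at hne ⊢
  cases l with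
  | nil => simp at hne
  | cons i l =>
    have hi : i ∈ l₁ ++ l₂ := hs.subset (by simp)
    refine ⟨i, (List.mem_append.1 hi).imp (h₁ i) (h₂ i), ?_⟩
    have hr' : cs.IsReduced l := by simpa using hr.drop 1
    rw [hr.eq, cs.wordProd_cons, cs.simple_mul_simple_cancel_left, hr'.eq, List.length_cons]
    omega

theorem mem_dihedral_of_mem_parabolic {s t a d : B} {w : W}
    (ha : cs.simple a ∈ parabolic cs {s, t}) (hd : cs.simple d ∈ parabolic cs {s, t})
    (hne : cs.simple d ≠ cs.simple a) (hw : w ∈ parabolic cs {s, t}) :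
    w ∈ dihedral cs d a := by
  obtain ⟨i, hi, hai⟩ := simple_mem_parabolic ha
  obtain ⟨j, hj, hdj⟩ := simple_mem_parabolic hd
  have hset : cs.simple '' {s, t} = {cs.simple d, cs.simple a} := by
    rw [Set.image_pair]
    rcases hi with rfl | rfl <;> rcases hj with rfl | rfl
    · exact absurd (hdj.trans hai.symm) hne
    · rw [hai, hdj, Set.pair_comm]
    · rw [hai, hdj]
    · exact absurd (hdj.trans hai.symm) hne
  rw [parabolic, hset] at hw
  exact hw

section Regularity

variable {φ : BSM cs} {a : B} {X Y : Set B}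

/-- The dihedral case of the commutation of `φ` with left multiplication by `c`. -/
theorem toFun_simple_mul_of_mem_parabolic (ha : φ.toFun 1 = cs.simple a)
    (hX : ∀ x ∈ X, x ≠ a → ∀ w ∈ dihedral cs x a,
      w ∈ φ.dom ∧ φ.toFun w = w * cs.simple a)
    (hY : ∀ y ∈ Y, y ≠ a → ∀ w ∈ dihedral cs y a,
      w ∈ φ.dom ∧ cs.simple a * w ∈ φ.dom ∧
      φ.toFun (cs.simple a * w) = cs.simple a * φ.toFun w)
    {u : W} {c s t : B} (hu : u ∈ parabolicProd cs X Y) (hc : c ∈ X)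
    (hcu : cs.length u < cs.length (cs.simple c * u))
    (hcφ : cs.length (φ.toFun u) < cs.length (cs.simple c * φ.toFun u))
    (hz : cs.simple c * u ∈ φ.dom)
    (hzz : bCov cs (cs.simple c * u) (φ.toFun (cs.simple c * u)))
    (hmem : φ.toFun (cs.simple c * u) ∈ parabolic cs {s, t}) :
    φ.toFun (cs.simple c * u) = cs.simple c * φ.toFun u := by
  have haD : cs.simple a ∈ parabolic cs {s, t} :=
    mem_parabolic_of_bruhatLE (ha ▸ toFun_one_bruhatLE φ hz hzz) hmem
  have hzD : cs.simple c * u ∈ parabolic cs {s, t} := mem_parabolic_of_bruhatLE hzz.1 hmem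
  have huD : u ∈ parabolic cs {s, t} :=
    mem_parabolic_of_bruhatLE (bruhatLE_simple_mul hcu) hzD
  have hright : ∀ d ∈ X, cs.simple d ∈ parabolic cs {s, t} → cs.simple d ≠ cs.simple a →
      φ.toFun (cs.simple c * u) = cs.simple c * φ.toFun u := by
    intro d hd hdD hne
    have hda : d ≠ a := fun h => hne (by rw [h])
    rw [(hX d hd hda _ (mem_dihedral_of_mem_parabolic haD hdD hne hzD)).2,
      (hX d hd hda _ (mem_dihedral_of_mem_parabolic haD hdD hne huD)).2, mul_assoc]
  by_cases hca : cs.simple c = cs.simple a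
  · have hu1 : u ≠ 1 := by
      rintro rfl
      rw [ha, hca] at hcφ
      simp at hcφ
    obtain ⟨d, hd, hlt⟩ := exists_left_descent_of_mem_parabolicProd hu hu1
    have hdD := mem_parabolic_of_bruhatLE (simple_bruhatLE hlt) huD
    have hne : cs.simple d ≠ cs.simple a := by
      intro h
      rw [h, ← hca] at hlt
      omega
    rcases hd with hd | hd
    · exact hright d hd hdD hne
    · rw [hca]
      exact (hY d hd (fun h => hne (by rw [h])) u
        (mem_dihedral_of_mem_parabolic haD hdD hne huD)).2.2
  · refine hright c hc (mem_parabolic_of_bruhatLE (simple_bruhatLE ?_) hzD) hca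
    rwa [cs.simple_mul_simple_cancel_left]

/-- On `⟨X⟩⟨Y⟩`, the matching `φ` commutes with left multiplication by the generators in `X`. -/
theorem toFun_simple_mul (hmax : BMax φ) (ha : φ.toFun 1 = cs.simple a)
    (hX : ∀ x ∈ X, x ≠ a → ∀ w ∈ dihedral cs x a,
      w ∈ φ.dom ∧ φ.toFun w = w * cs.simple a)
    (hY : ∀ y ∈ Y, y ≠ a → ∀ w ∈ dihedral cs y a,
      w ∈ φ.dom ∧ cs.simple a * w ∈ φ.dom ∧
      φ.toFun (cs.simple a * w) = cs.simple a * φ.toFun w)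
    {u : W} (hu : u ∈ φ.dom) (huI : u ∈ parabolicProd cs X Y) {c : B} (hc : c ∈ X) :
    cs.simple c * u ∈ φ.dom ∧ φ.toFun (cs.simple c * u) = cs.simple c * φ.toFun u := by
  induction hn : cs.length u using Nat.strong_induction_on generalizing u c with
  | _ n ih =>
  have hcc : ∀ w : W, cs.simple c * (cs.simple c * w) = w :=
    fun w => cs.simple_mul_simple_cancel_left c
  have ih' : ∀ v, bruhatLE cs v u → cs.length v < cs.length u → cs.simple c * v ∈ φ.dom ∧
      φ.toFun (cs.simple c * v) = cs.simple c * φ.toFun v := fun v hv hlt =>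
    ih _ (by omega) (φ.ideal hu hv) (mem_parabolicProd_of_bruhatLE hv huI) hc rfl
  rcases cs.length_simple_mul u c with hcu | hcu
  swap
  · have hle : bruhatLE cs (cs.simple c * u) u := simple_mul_bruhatLE (by omega)
    have h := (ih' _ hle (by omega)).2
    rw [hcc] at h
    exact ⟨φ.ideal hu hle, by rw [h, hcc]⟩
  rcases length_toFun φ hu with huu | huu
  swap
  · obtain ⟨h1, h2⟩ := ih' _ (toFun_bCov φ hu huu).1 (by omega)
    rw [φ.invol u hu] at h2
    rw [← h2]
    exact ⟨φ.maps _ h1, φ.invol _ h1⟩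
  have huc := bCov_toFun φ hu huu
  rcases cs.length_simple_mul (φ.toFun u) c with hcφ | hcφ
  swap
  · have h1 := bruhatLE_simple_mul_of_lt_of_gt huc.1 (i := c) (by omega) (by omega)
    have h2 := eq_of_bruhatLE_of_length_le h1 (by omega)
    have h3 : cs.simple c * u = φ.toFun u := by
      rw [h2, hcc, ← h2]
    rw [h3, φ.invol u hu]
    exact ⟨φ.maps u hu, h2⟩
  have hcoat := bCoat_simple_mul_toFun hu huu hcu hcφ
    fun v hv => ih' v hv.1 (by have := (bCov_iff.1 hv).2; omega)
  have hzdesc : ∀ v, bCov cs v (cs.simple c * u) → v = u ∨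
      ∃ v', bCov cs v' u ∧ cs.simple c * v' = v := by
    intro v hv
    obtain ⟨h1, h2⟩ := bCov_iff.1 hv
    rcases cs.length_simple_mul v c with hcv | hcv
    · left
      have h3 := bruhatLE_simple_mul_of_lt_of_gt h1 (i := c) (by omega) (by rw [hcc]; omega)
      rw [hcc] at h3
      exact eq_of_bruhatLE_of_length_le h3 (by omega)
    · right
      have h3 := simple_mul_mono_of_gt h1 (i := c) (by omega) (by rw [hcc]; omega)
      rw [hcc] at h3
      exact ⟨cs.simple c * v, bCov_iff.2 ⟨h3, by omega⟩, hcc v⟩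
  have hzp : bCov cs (cs.simple c * u) (cs.simple c * φ.toFun u) :=
    bCov_iff.2 ⟨simple_mul_mono_of_lt huc.1 (by omega) (by omega), by omega⟩
  have hz : cs.simple c * u ∈ φ.dom := by
    refine mem_dom_of_bCoat_eq hmax hzp (fun v hv => ?_) hcoat
    rcases hzdesc v hv with rfl | ⟨v', hv', rfl⟩
    · exact hu
    · exact (ih' v' hv'.1 (by have := (bCov_iff.1 hv').2; omega)).1
  refine ⟨hz, ?_⟩
  rcases length_toFun φ hz with hzl | hzl
  swap
  · exfalso
    rcases hzdesc _ (toFun_bCov φ hz hzl) with h | ⟨v, hv, h⟩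
    · rw [← h, φ.invol _ hz, hcc] at hcφ
      omega
    · have hvl := (bCov_iff.1 hv).2
      have h1 := (ih' v hv.1 (by omega)).2
      rw [h, φ.invol _ hz] at h1
      have h2 := mul_left_cancel h1
      rw [h2, φ.invol v (φ.ideal hu hv.1)] at huu
      rw [h2] at hvl
      omega
  have hzz := bCov_toFun φ hz hzl
  by_contra hne
  obtain ⟨s, t, hs, -⟩ := exists_dihedral_of_bCoat_eq
    ((φ.coatom _ hz hzz).trans hcoat.symm)
    (fun h => by rw [h] at hzl; simp at hzl)
    (fun h => by rw [h] at hcφ; simp at hcφ) hne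
  exact hne (toFun_simple_mul_of_mem_parabolic ha hX hY huI hc (by omega) (by omega) hz hzz hs)

end Regularity

end CoxeterBruhat

/-- if `φ` restricted to `P_x` is right multiplication by `a` for every
`x ∈ X \ {a}` and is left `a`-regular on `P_y` for every `y ∈ Y \ {a}`, then
`⟨X⟩ (⟨Y⟩ ∩ Q) ⊆ Q` and `φ(xy) = x φ(y)` there. -/
theorem stmt12 {B : Type*} {W : Type*} [Group W] {M : CoxeterMatrix B}
    (cs : CoxeterSystem M W) (φ : BSM cs) (hmax : BMax φ)
    (h1 : (1 : W) ∈ φ.dom) (a : B) (ha : φ.toFun 1 = cs.simple a)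
    (X Y : Set B)
    (hX : ∀ x ∈ X, x ≠ a → ∀ w ∈ dihedral cs x a,
      w ∈ φ.dom ∧ φ.toFun w = w * cs.simple a)
    (hY : ∀ y ∈ Y, y ≠ a → ∀ w ∈ dihedral cs y a,
      w ∈ φ.dom ∧ cs.simple a * w ∈ φ.dom ∧
      φ.toFun (cs.simple a * w) = cs.simple a * φ.toFun w) :
    ∀ x ∈ (Subgroup.closure (cs.simple '' X) : Subgroup W),
      ∀ y ∈ (Subgroup.closure (cs.simple '' Y) : Subgroup W), y ∈ φ.dom →
        x * y ∈ φ.dom ∧ φ.toFun (x * y) = x * φ.toFun y := by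
  open CoxeterBruhat in
  intro x hx y hy hyd
  obtain ⟨l, hl, rfl⟩ := exists_word_of_mem_parabolic hx
  clear hx
  induction l with
  | nil => simpa using hyd
  | cons c l ih =>
    have hl' : ∀ i ∈ l, i ∈ X := fun i hi => hl i (by simp [hi])
    obtain ⟨h2, h3⟩ := ih hl'
    obtain ⟨h4, h5⟩ := toFun_simple_mul hmax ha hX hY h2
      (mul_mem_parabolicProd (wordProd_mem_parabolic hl') hy) (hl c (by simp))
    rw [cs.wordProd_cons, mul_assoc, mul_assoc, ← h3]
    exact ⟨h4, h5⟩
end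

section
/- Let (W, S) be a Coxeter system, (Q, φ) a maximal partial special matching with a = φ(e). Define G = {g ∈ S : φ(g) = ga} and D = {d ∈ S : φ(d) = ad}. Then Q ⊆ ⟨G⟩⟨D⟩, i.e. every element of the domain Q factors as a product of an element of the standard parabolic subgroup ⟨G⟩ and an element of ⟨D⟩. -/
open CoxeterSystem Polynomial

namespace CoxeterSystem

variable {B : Type*} {W : Type*} [Group W] {M : CoxeterMatrix B} (cs : CoxeterSystem M W)

section StrongExchange

open Classical in
/-- The action of a simple reflection on pairs consisting of a group element and a sign:
conjugation on the first component, with a sign change at the simple reflection itself. -/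
noncomputable def signFlip (i : B) : Function.End (W × ZMod 2) := fun p =>
  (cs.simple i * p.1 * cs.simple i, p.2 + if p.1 = cs.simple i then 1 else 0)

open Classical in
lemma signFlip_mul_pow_apply (i j : B) (k : ℕ) (x : W) (e : ZMod 2) :
    ((cs.signFlip i * cs.signFlip j) ^ k) (x, e) =
      ((cs.simple i * cs.simple j) ^ k * x * ((cs.simple i * cs.simple j) ^ k)⁻¹,
        e + ∑ n ∈ Finset.range (2 * k),
          if x = (cs.simple j * cs.simple i) ^ n * cs.simple j then 1 else 0) := by
  have hconj : ∀ k : ℕ, (cs.simple j * cs.simple i) ^ k * cs.simple j =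
      cs.simple j * (cs.simple i * cs.simple j) ^ k := by
    intro k
    induction k with
    | zero => simp
    | succ k ih => rw [pow_succ', mul_assoc, ih, pow_succ']; simp [mul_assoc]
  have hinv : ∀ k : ℕ, ((cs.simple i * cs.simple j) ^ k)⁻¹ = (cs.simple j * cs.simple i) ^ k := by
    intro k; rw [← inv_pow]; simp
  induction k with
  | zero => simp; rfl
  | succ k ih =>
    rw [pow_succ']
    change cs.signFlip i (cs.signFlip j (((cs.signFlip i * cs.signFlip j) ^ k) (x, e))) = _
    rw [ih]
    have h1 : ((cs.simple i * cs.simple j) ^ k * x * ((cs.simple i * cs.simple j) ^ k)⁻¹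
        = cs.simple j) ↔ x = (cs.simple j * cs.simple i) ^ (2 * k) * cs.simple j := by
      have e : (cs.simple j * cs.simple i) ^ (2 * k) * cs.simple j =
          ((cs.simple i * cs.simple j) ^ k)⁻¹ * cs.simple j * (cs.simple i * cs.simple j) ^ k := by
        rw [two_mul, pow_add, mul_assoc, hconj, hinv, mul_assoc]
      rw [e]
      generalize (cs.simple i * cs.simple j) ^ k = A
      constructor
      · intro h; rw [← h]; group
      · rintro rfl; group
    have h2 : (cs.simple j * ((cs.simple i * cs.simple j) ^ k * x *
        ((cs.simple i * cs.simple j) ^ k)⁻¹) * cs.simple j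
        = cs.simple i) ↔ x = (cs.simple j * cs.simple i) ^ (2 * k + 1) * cs.simple j := by
      have e : (cs.simple j * cs.simple i) ^ (2 * k + 1) * cs.simple j =
          ((cs.simple i * cs.simple j) ^ k)⁻¹ * (cs.simple j * cs.simple i * cs.simple j) *
            (cs.simple i * cs.simple j) ^ k := by
        rw [show 2 * k + 1 = k + (1 + k) by ring, pow_add, pow_add, mul_assoc, mul_assoc, hconj,
          hinv, pow_one]
        simp only [mul_assoc]
      rw [e]
      generalize (cs.simple i * cs.simple j) ^ k = A
      constructor
      · intro h; rw [← h]; simp [mul_assoc]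
      · rintro rfl; simp [mul_assoc]
    simp only [signFlip, h1, h2]
    rw [show 2 * (k + 1) = 2 * k + 1 + 1 by ring, Finset.sum_range_succ, Finset.sum_range_succ]
    refine Prod.ext ?_ ?_
    · simp [pow_succ', mul_assoc]
    · simp only [add_assoc]

lemma signFlip_isLiftable : M.IsLiftable cs.signFlip := by
  classical
  intro i j
  funext p
  obtain ⟨x, e⟩ := p
  have hp : (cs.simple j * cs.simple i) ^ M i j = 1 := by
    rw [M.symmetric i j]; exact cs.simple_mul_simple_pow j i
  rw [signFlip_mul_pow_apply, two_mul, Finset.sum_range_add]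
  simp only [pow_add, hp, one_mul, cs.simple_mul_simple_pow, CharTwo.add_self_eq_zero]
  simp; rfl

/-- The action of a Coxeter group on pairs of a group element and a sign. -/
noncomputable def signAction : W →* Function.End (W × ZMod 2) :=
  cs.lift ⟨cs.signFlip, cs.signFlip_isLiftable⟩

open Classical in
lemma signAction_wordProd (ω : List B) (x : W) (e : ZMod 2) :
    cs.signAction (cs.wordProd ω) (x, e) =
      (cs.wordProd ω * x * (cs.wordProd ω)⁻¹, e + ((cs.rightInvSeq ω).count x : ZMod 2)) := by
  induction ω with
  | nil => simp; rfl
  | cons i ω ih =>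
    rw [wordProd_cons, map_mul]
    change cs.signAction (cs.simple i) (cs.signAction (cs.wordProd ω) (x, e)) = _
    rw [ih, signAction, lift_apply_simple]
    have h : (cs.wordProd ω * x * (cs.wordProd ω)⁻¹ = cs.simple i) ↔
        (cs.wordProd ω)⁻¹ * cs.simple i * cs.wordProd ω = x := by
      constructor
      · intro h; rw [← h]; group
      · rintro rfl; group
    simp only [signFlip, rightInvSeq, List.count_cons, h, beq_iff_eq]
    refine Prod.ext ?_ ?_
    · simp [mul_assoc]
    · push_cast; simp only [add_assoc]

lemma signAction_shift (w x : W) (e : ZMod 2) :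
    cs.signAction w (x, e) = (w * x * w⁻¹, e + (cs.signAction w (x, 0)).2) := by
  classical
  obtain ⟨ω, rfl⟩ := cs.wordProd_surjective w
  simp [signAction_wordProd]

lemma signAction_reflection {t : W} (ht : cs.IsReflection t) :
    (cs.signAction t (t, 0)).2 = 1 := by
  obtain ⟨u, i, rfl⟩ := ht
  have hs : ∀ e, cs.signAction (cs.simple i) (cs.simple i, e) = (cs.simple i, e + 1) := by
    intro e
    rw [signAction, lift_apply_simple]
    simp [signFlip]
  have hu : cs.signAction u (cs.signAction u⁻¹ (u * cs.simple i * u⁻¹, 0)) =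
      (u * cs.simple i * u⁻¹, 0) := by
    change (cs.signAction u * cs.signAction u⁻¹) _ = _
    rw [← map_mul, mul_inv_cancel, map_one]; rfl
  rw [map_mul, map_mul]
  change (cs.signAction u (cs.signAction (cs.simple i) (cs.signAction u⁻¹ _))).2 = 1
  rw [signAction_shift cs u⁻¹] at hu ⊢
  rw [show u⁻¹ * (u * cs.simple i * u⁻¹) * u⁻¹⁻¹ = cs.simple i by group] at hu ⊢
  rw [hs]
  rw [signAction_shift] at hu ⊢
  have := congrArg Prod.snd hu
  simp only at this ⊢
  rw [add_right_comm, this, zero_add]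

/-- The strong exchange property. -/
theorem exists_deletion_of_length_mul_lt (ω : List B) {t : W} (ht : cs.IsReflection t)
    (h : cs.length (cs.wordProd ω * t) < cs.length (cs.wordProd ω)) :
    ∃ α b β, ω = α ++ b :: β ∧ cs.wordProd ω * t = cs.wordProd (α ++ β) := by
  classical
  have hmem : t ∈ cs.rightInvSeq ω := by
    by_contra hn
    have h0 : (cs.signAction (cs.wordProd ω) (t, 0)).2 = 0 := by
      simp [signAction_wordProd, List.count_eq_zero_of_not_mem hn]
    obtain ⟨ω', hω', he⟩ := cs.exists_isReduced (cs.wordProd ω * t)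
    have h1 : (cs.signAction (cs.wordProd ω * t) (t, 0)).2 = 1 := by
      rw [map_mul]
      change (cs.signAction (cs.wordProd ω) (cs.signAction t (t, 0))).2 = 1
      rw [signAction_shift cs t, signAction_shift]
      simp [signAction_reflection cs ht, h0]
    rw [he, signAction_wordProd] at h1
    have hm : t ∈ cs.rightInvSeq ω' := by
      by_contra hm
      simp [List.count_eq_zero_of_not_mem hm] at h1
    have := (cs.isRightInversion_of_mem_rightInvSeq hω' hm).2
    rw [← he, mul_assoc, ht.mul_self, mul_one] at this
    omega
  obtain ⟨j, hj, rfl⟩ := List.getElem_of_mem hmem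
  have hj' : j < ω.length := by simpa using hj
  refine ⟨ω.take j, ω[j], ω.drop (j + 1), by simp, ?_⟩
  rw [← List.eraseIdx_eq_take_drop_succ, ← wordProd_mul_getD_rightInvSeq,
    List.getD_eq_getElem _ _ hj]

end StrongExchange

section Subwords

variable {cs}

lemma IsReduced.of_append {α β : List B} (h : cs.IsReduced (α ++ β)) :
    cs.IsReduced α ∧ cs.IsReduced β := by
  have h1 := h.take α.length
  have h2 := h.drop α.length
  simp only [List.take_left, List.drop_left] at h1 h2
  exact ⟨h1, h2⟩

lemma IsReduced.of_cons {i : B} {ω : List B} (h : cs.IsReduced (i :: ω)) : cs.IsReduced ω :=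
  (IsReduced.of_append (α := [i]) h).2

variable (cs)

lemma exists_isReduced_sublist (ω : List B) :
    ∃ ω', ω'.Sublist ω ∧ cs.IsReduced ω' ∧ cs.wordProd ω' = cs.wordProd ω := by
  induction ω with
  | nil => exact ⟨[], List.Sublist.refl _, by simp [IsReduced], rfl⟩
  | cons i ω ih =>
    obtain ⟨γ, hγ, hr, he⟩ := ih
    rcases cs.length_simple_mul (cs.wordProd γ) i with h | h
    · refine ⟨i :: γ, hγ.cons_cons i, ?_, by simp [wordProd_cons, he]⟩
      rw [IsReduced, wordProd_cons, h, hr.eq]; simp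
    · have e : cs.wordProd γ * ((cs.wordProd γ)⁻¹ * cs.simple i * cs.wordProd γ) =
          cs.simple i * cs.wordProd γ := by group
      obtain ⟨α, b, β, rfl, h2⟩ := cs.exists_deletion_of_length_mul_lt γ
        (t := (cs.wordProd γ)⁻¹ * cs.simple i * cs.wordProd γ)
        ⟨(cs.wordProd γ)⁻¹, i, by simp⟩ (by rw [e]; omega)
      rw [e] at h2
      refine ⟨α ++ β, ?_, ?_, ?_⟩
      · exact ((List.Sublist.append_left (List.sublist_cons_self b β) α).trans hγ).cons i
      · have := hr.eq
        rw [IsReduced, ← h2]; simp at this ⊢; omega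
      · rw [← h2, wordProd_cons, he]

lemma exists_sublist_of_bruhatLE {x y : W} (h : bruhatLE cs x y) :
    ∀ ω, cs.wordProd ω = y → ∃ ω', ω'.Sublist ω ∧ cs.IsReduced ω' ∧ cs.wordProd ω' = x := by
  induction h using Relation.ReflTransGen.head_induction_on with
  | refl => rintro ω rfl; exact cs.exists_isReduced_sublist ω
  | @head u v huv _ ih =>
    intro ω hω
    obtain ⟨γ, hγ, -, rfl⟩ := ih ω hω
    obtain ⟨t, ht, he, hl⟩ := huv
    have hu : cs.wordProd γ * t = u := by rw [he, mul_assoc, ht.mul_self, mul_one]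
    obtain ⟨α, b, β, rfl, h2⟩ := cs.exists_deletion_of_length_mul_lt γ ht (by rwa [hu])
    obtain ⟨δ, hδ, hr, hd⟩ := cs.exists_isReduced_sublist (α ++ β)
    exact ⟨δ, hδ.trans ((List.Sublist.append_left (List.sublist_cons_self b β) α).trans hγ), hr,
      by rw [hd, ← h2, hu]⟩

lemma simple_mul_lt_or_eq {x t : W} (ht : cs.IsReflection t)
    (h : cs.length x < cs.length (x * t)) (i : B) :
    cs.simple i * x = x * t ∨ cs.length (cs.simple i * x) < cs.length (cs.simple i * x * t) := by
  by_contra! hc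
  obtain ⟨hne, hle⟩ := hc
  obtain ⟨ω, hω, rfl⟩ := cs.exists_isReduced x
  have hlt := lt_of_le_of_ne hle (ht.length_mul_left_ne _)
  rw [← wordProd_cons] at hlt
  obtain ⟨α, b, β, h1, h2⟩ := cs.exists_deletion_of_length_mul_lt (i :: ω) ht hlt
  rw [wordProd_cons] at h2
  cases α with
  | nil =>
    simp only [List.nil_append, List.cons.injEq] at h1 h2
    apply hne
    rw [← h1.2] at h2
    rw [← h2, mul_assoc (_ * _), ht.mul_self, mul_one, h2]
  | cons k α =>
    simp only [List.cons_append, List.cons.injEq] at h1 h2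
    obtain ⟨rfl, rfl⟩ := h1
    rw [wordProd_cons, mul_assoc, mul_right_inj] at h2
    have := cs.length_wordProd_le (α ++ β)
    have hr := hω.eq
    rw [h2] at h
    simp at this hr
    omega

lemma bruhatLE_simple_mul {x y : W} (h : bruhatLE cs x y) (i : B) :
    bruhatLE cs (cs.simple i * x) y ∨ bruhatLE cs (cs.simple i * x) (cs.simple i * y) := by
  induction h with
  | refl => exact Or.inr .refl
  | @tail y z hxy hyz ih =>
    have hstep := hyz
    obtain ⟨t, ht, rfl, hl⟩ := hyz
    rcases ih with ih | ih
    · exact Or.inl (ih.tail hstep)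
    · rcases cs.simple_mul_lt_or_eq ht hl i with h | h
      · left; rw [← h]; exact ih
      · right; exact ih.tail ⟨t, ht, (mul_assoc _ _ _).symm, by rwa [← mul_assoc]⟩

lemma bruhatLE_simple_mul_self {x : W} {i : B}
    (h : cs.length x < cs.length (cs.simple i * x)) : bruhatLE cs x (cs.simple i * x) :=
  .single ⟨x⁻¹ * cs.simple i * x, ⟨x⁻¹, i, by simp⟩, by group, h⟩

lemma length_lt_of_isReduced_cons {i : B} {ω : List B} (h : cs.IsReduced (i :: ω)) :
    cs.length (cs.simple i * cs.wordProd ω) = cs.length (cs.wordProd ω) + 1 := by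
  rw [h.of_cons.eq, ← wordProd_cons, h.eq]; rfl

lemma bruhatLE_of_sublist {ω ω' : List B} (h : ω'.Sublist ω) (hr : cs.IsReduced ω) :
    bruhatLE cs (cs.wordProd ω') (cs.wordProd ω) := by
  induction h with
  | slnil => exact .refl
  | @cons l₁ l₂ i h ih =>
    rw [wordProd_cons cs i l₂]
    have := cs.length_lt_of_isReduced_cons hr
    exact (ih hr.of_cons).trans (cs.bruhatLE_simple_mul_self (by omega))
  | @cons_cons l₁ l₂ i h ih =>
    rw [wordProd_cons, wordProd_cons]
    have := cs.length_lt_of_isReduced_cons hr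
    rcases cs.bruhatLE_simple_mul (ih hr.of_cons) i with h | h
    · exact h.trans (cs.bruhatLE_simple_mul_self (by omega))
    · exact h

variable {cs} in
lemma eq_or_length_lt_of_bruhatLE {x y : W} (h : bruhatLE cs x y) :
    x = y ∨ cs.length x < cs.length y := by
  induction h with
  | refl => exact Or.inl rfl
  | tail _ hyz ih =>
    obtain ⟨t, _, _, hl⟩ := hyz
    rcases ih with rfl | ih
    · exact Or.inr hl
    · exact Or.inr (ih.trans hl)

lemma exists_bruhatLE_length_succ {ω : List B} (hr : cs.IsReduced ω) :
    ∀ u, bruhatLE cs u (cs.wordProd ω) → u ≠ cs.wordProd ω →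
      ∃ z, bruhatLE cs u z ∧ bruhatLE cs z (cs.wordProd ω) ∧
        cs.length z + 1 = cs.length (cs.wordProd ω) := by
  induction ω with
  | nil =>
    intro u hu hne
    obtain ⟨ω', hs, -, rfl⟩ := cs.exists_sublist_of_bruhatLE hu [] rfl
    simp [List.sublist_nil.mp hs] at hne
  | cons i ω ih =>
    intro u hu hne
    have hl := cs.length_lt_of_isReduced_cons hr
    have hup : bruhatLE cs (cs.wordProd ω) (cs.wordProd (i :: ω)) := by
      rw [wordProd_cons]; exact cs.bruhatLE_simple_mul_self (by omega)
    have hbelow : bruhatLE cs u (cs.wordProd ω) → ∃ z, bruhatLE cs u z ∧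
        bruhatLE cs z (cs.wordProd (i :: ω)) ∧
        cs.length z + 1 = cs.length (cs.wordProd (i :: ω)) := fun h =>
      ⟨cs.wordProd ω, h, hup, by rw [wordProd_cons, hl]⟩
    obtain ⟨ω', hs, -, rfl⟩ := cs.exists_sublist_of_bruhatLE hu _ rfl
    cases hs with
    | cons _ hs => exact hbelow (cs.bruhatLE_of_sublist hs hr.of_cons)
    | @cons_cons γ _ _ hs =>
      obtain ⟨z, h1, h2, h3⟩ := ih hr.of_cons (cs.wordProd γ)
        (cs.bruhatLE_of_sublist hs hr.of_cons) (by rintro h; simp [wordProd_cons, h] at hne)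
      rw [wordProd_cons cs i γ] at *
      rcases cs.bruhatLE_simple_mul h1 i with h | h
      · exact hbelow (h.trans h2)
      · rcases cs.length_simple_mul z i with hz | hz
        · refine ⟨cs.simple i * z, h, ?_, by rw [wordProd_cons]; omega⟩
          rcases cs.bruhatLE_simple_mul h2 i with h' | h'
          · exact h'.trans hup
          · rwa [wordProd_cons]
        · have := cs.bruhatLE_simple_mul_self (x := cs.simple i * z) (i := i) (by simp; omega)
          rw [simple_mul_simple_cancel_left] at this
          exact hbelow (h.trans (this.trans h2))

variable {cs} in
lemma length_of_bCov {u v : W} (h : bCov cs u v) : cs.length v = cs.length u + 1 := by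
  obtain ⟨h1, h2, h3⟩ := h
  obtain ⟨ω, hω, rfl⟩ := cs.exists_isReduced v
  obtain ⟨z, hz1, hz2, hz3⟩ := cs.exists_bruhatLE_length_succ hω u h1 h2
  rcases h3 z hz1 hz2 with rfl | rfl <;> omega

variable {cs} in
lemma bCov_of_length {u v : W} (h : bruhatLE cs u v) (hl : cs.length v = cs.length u + 1) :
    bCov cs u v := by
  refine ⟨h, by rintro rfl; omega, fun z h1 h2 => ?_⟩
  rcases eq_or_length_lt_of_bruhatLE h1 with h | h
  · exact Or.inl h.symm
  · rcases eq_or_length_lt_of_bruhatLE h2 with h' | h'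
    · exact Or.inr h'
    · omega

variable {cs} in
lemma exists_coatom_of_bruhatLE {u v : W} (h : bruhatLE cs u v) (hne : u ≠ v) :
    ∃ z, bruhatLE cs u z ∧ bCov cs z v := by
  obtain ⟨ω, hω, rfl⟩ := cs.exists_isReduced v
  obtain ⟨z, hz1, hz2, hz3⟩ := cs.exists_bruhatLE_length_succ hω u h hne
  exact ⟨z, hz1, bCov_of_length hz2 hz3.symm⟩

lemma _root_.List.Sublist.exists_eq_append_cons {α : Type*} {l l' : List α} (h : l'.Sublist l)
    (hl : l.length = l'.length + 1) : ∃ p b q, l = p ++ b :: q ∧ l' = p ++ q := by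
  induction h with
  | slnil => simp at hl
  | @cons l₁ l₂ i h ih =>
    exact ⟨[], i, l₂, rfl, h.eq_of_length (by simpa using hl.symm)⟩
  | @cons_cons l₁ l₂ i h ih =>
    obtain ⟨p, b, q, rfl, rfl⟩ := ih (by simpa using hl)
    exact ⟨i :: p, b, q, rfl, rfl⟩

lemma _root_.List.Sublist.mem_right_of_pair {α : Type*} {p q : List α} {x y b : α}
    (h : [x, y].Sublist (p ++ b :: q)) (hx : x ∉ p) : y ∈ q := by
  induction p with
  | nil =>
    cases h with
    | cons _ h => exact h.subset (by simp)
    | cons_cons _ h => exact h.subset (by simp)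
  | cons i p ih =>
    cases h with
    | cons _ h => exact ih h (by simp_all)
    | cons_cons _ h => simp at hx

lemma _root_.List.Sublist.mem_left_of_pair {α : Type*} {p q : List α} {x y b : α}
    (h : [x, y].Sublist (p ++ b :: q)) (hy : y ∉ q) : x ∈ p := by
  have h' := h.reverse
  simp only [List.reverse_append, List.reverse_cons, List.reverse_nil, List.nil_append,
    List.append_assoc, List.singleton_append] at h'
  exact List.mem_reverse.mp (h'.mem_right_of_pair (by simpa using hy))

lemma _root_.List.Sublist.eq_or_of_pair_of_triple {α : Type*} {x y p q r : α}
    (h : [x, y].Sublist [p, q, r]) :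
    x = p ∧ y = q ∨ x = p ∧ y = r ∨ x = q ∧ y = r := by
  cases h with
  | cons _ h =>
    have := h.eq_of_length rfl
    simp_all
  | cons_cons _ h =>
    have : y = q ∨ y = r := by simpa using h
    tauto

/-- A list of length four has no two opposite sublists of three distinct entries. -/
lemma _root_.List.Sublist.false_of_triple_of_reverse {α : Type*} {l : List α} {p q r : α}
    (h : [p, q, r].Sublist l) (h' : [r, q, p].Sublist l) (hl : l.length = 4)
    (hpq : p ≠ q) (hqr : q ≠ r) (hpr : p ≠ r) : False := by
  obtain ⟨α, b, β, rfl, h1⟩ := h.exists_eq_append_cons (by simpa using hl)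
  obtain ⟨γ, c, δ, h2, h3⟩ := h'.exists_eq_append_cons (by simpa using hl)
  rcases α with _ | ⟨_, _ | ⟨_, _ | ⟨_, _ | _⟩⟩⟩ <;>
    rcases γ with _ | ⟨_, _ | ⟨_, _ | ⟨_, _ | _⟩⟩⟩ <;> grind

/-- A lower cover is obtained from any reduced word by deleting one letter. -/
lemma exists_deletion_of_bCov {ω : List B} (hr : cs.IsReduced ω) {u : W}
    (h : bCov cs u (cs.wordProd ω)) :
    ∃ α b β, ω = α ++ b :: β ∧ u = cs.wordProd (α ++ β) ∧ cs.IsReduced (α ++ β) := by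
  obtain ⟨γ, hγ, hγr, rfl⟩ := cs.exists_sublist_of_bruhatLE h.1 ω rfl
  have := length_of_bCov h
  rw [hr.eq, hγr.eq] at this
  obtain ⟨α, b, β, rfl, rfl⟩ := hγ.exists_eq_append_cons this
  exact ⟨α, b, β, rfl, rfl, hγr⟩

lemma exists_mem_of_simple_bruhatLE {i : B} {ω : List B}
    (h : bruhatLE cs (cs.simple i) (cs.wordProd ω)) : ∃ j ∈ ω, cs.simple j = cs.simple i := by
  obtain ⟨γ, hγ, hγr, he⟩ := cs.exists_sublist_of_bruhatLE h ω rfl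
  have hl := hγr.eq
  rw [he, cs.length_simple] at hl
  obtain ⟨j, rfl⟩ := List.length_eq_one_iff.mp hl.symm
  exact ⟨j, hγ.subset (by simp), by simpa using he⟩

lemma simple_bruhatLE_of_mem {i : B} {ω : List B} (hr : cs.IsReduced ω) (h : i ∈ ω) :
    bruhatLE cs (cs.simple i) (cs.wordProd ω) := by
  have := cs.bruhatLE_of_sublist (List.singleton_sublist.mpr h) hr
  simpa using this

/-- The letters of a reduced word occur in every word of any larger element. -/
lemma forall_letters_of_bruhatLE {ω γ : List B} (hr : cs.IsReduced ω)
    (h : bruhatLE cs (cs.wordProd ω) (cs.wordProd γ)) {P : W → Prop}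
    (hP : ∀ j ∈ γ, P (cs.simple j)) : ∀ i ∈ ω, P (cs.simple i) := by
  intro i hi
  obtain ⟨j, hj, he⟩ :=
    cs.exists_mem_of_simple_bruhatLE ((cs.simple_bruhatLE_of_mem hr hi).trans h)
  rw [← he]; exact hP j hj

lemma forall_letters_of_eq {ω γ : List B} (hr : cs.IsReduced ω)
    (h : cs.wordProd ω = cs.wordProd γ) {P : W → Prop}
    (hP : ∀ j ∈ γ, P (cs.simple j)) : ∀ i ∈ ω, P (cs.simple i) :=
  cs.forall_letters_of_bruhatLE hr (h ▸ .refl) hP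

lemma isReduced_pair {p q : B} (h : cs.simple p ≠ cs.simple q) : cs.IsReduced [p, q] := by
  have h2 := cs.length_mul_simple (cs.simple p) q
  rw [cs.length_simple] at h2
  have : cs.length (cs.simple p * cs.simple q) ≠ 0 := by
    rw [Ne, length_eq_zero_iff, mul_eq_one_iff_eq_inv]; simpa using h
  simp [IsReduced, wordProd_cons]; omega

lemma exists_pair_sublist {p q : B} (hpq : cs.simple p * cs.simple q ≠ cs.simple q * cs.simple p)
    {ω : List B} (h : bruhatLE cs (cs.simple p * cs.simple q) (cs.wordProd ω)) :
    ∃ x y, [x, y].Sublist ω ∧ cs.simple x = cs.simple p ∧ cs.simple y = cs.simple q := by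
  have hne : cs.simple p ≠ cs.simple q := fun h => hpq (by rw [h])
  have hr := cs.isReduced_pair hne
  obtain ⟨γ, hγ, hγr, he⟩ := cs.exists_sublist_of_bruhatLE h ω rfl
  have he' : cs.wordProd γ = cs.wordProd [p, q] := by simpa [wordProd_cons] using he
  have hl := hγr.eq
  rw [he', hr.eq] at hl
  obtain ⟨x, y, rfl⟩ := List.length_eq_two.mp hl.symm
  have h1 := cs.forall_letters_of_eq hγr he' (P := fun w => w = cs.simple p ∨ w = cs.simple q)
    (by simp)
  have h2 := cs.forall_letters_of_eq hr he'.symm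
    (P := fun w => w = cs.simple x ∨ w = cs.simple y) (by simp)
  simp only [List.mem_cons, List.not_mem_nil, or_false, forall_eq_or_imp, forall_eq] at h1 h2
  refine ⟨x, y, hγ, ?_⟩
  simp only [wordProd_cons, wordProd_nil, mul_one] at he
  grind

open Classical in
lemma countP_le_one_of_cons {ω γ : List B} {t : B} (hr : cs.IsReduced ω)
    (hr' : cs.IsReduced (t :: γ)) (h : cs.wordProd ω = cs.wordProd (t :: γ))
    (hγ : ∀ j ∈ γ, cs.simple j ≠ cs.simple t) :
    ω.countP (fun j => cs.simple j = cs.simple t) ≤ 1 := by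
  have hl := cs.length_lt_of_isReduced_cons hr'
  have hc : bCov cs (cs.wordProd γ) (cs.wordProd ω) := by
    rw [h, wordProd_cons]
    exact bCov_of_length (cs.bruhatLE_simple_mul_self (by omega)) hl
  obtain ⟨α, b, β, rfl, h1, h2⟩ := cs.exists_deletion_of_bCov hr hc
  have h3 := cs.forall_letters_of_eq h2 h1.symm (P := fun w => w ≠ cs.simple t) hγ
  have h4 : (α ++ β).countP (fun j => cs.simple j = cs.simple t) = 0 := by
    rw [List.countP_eq_zero]; simpa using h3
  rw [List.countP_append] at h4 ⊢
  rw [List.countP_cons]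
  split <;> omega

open Classical in
lemma countP_le_one_of_concat {ω γ : List B} {t : B} (hr : cs.IsReduced ω)
    (hr' : cs.IsReduced (γ ++ [t])) (h : cs.wordProd ω = cs.wordProd (γ ++ [t]))
    (hγ : ∀ j ∈ γ, cs.simple j ≠ cs.simple t) :
    ω.countP (fun j => cs.simple j = cs.simple t) ≤ 1 := by
  rw [← List.countP_reverse]
  refine cs.countP_le_one_of_cons (γ := γ.reverse) hr.reverse ?_ ?_ (by simpa using hγ)
  · simpa using hr'.reverse
  · have : t :: γ.reverse = (γ ++ [t]).reverse := by simp
    rw [this, wordProd_reverse, wordProd_reverse, h]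

lemma exists_word_of_mem_closure {S : Set B} {w : W}
    (h : w ∈ Subgroup.closure (cs.simple '' S)) :
    ∃ ω, cs.IsReduced ω ∧ cs.wordProd ω = w ∧ ∀ i ∈ ω, i ∈ S := by
  suffices ∃ ω, cs.wordProd ω = w ∧ ∀ i ∈ ω, i ∈ S by
    obtain ⟨ω, rfl, hS⟩ := this
    obtain ⟨γ, h1, h2, h3⟩ := cs.exists_isReduced_sublist ω
    exact ⟨γ, h2, h3, fun i hi => hS i (h1.subset hi)⟩
  induction h using Subgroup.closure_induction with
  | mem x hx => obtain ⟨i, hi, rfl⟩ := hx; exact ⟨[i], by simp, by simpa using hi⟩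
  | one => exact ⟨[], by simp, by simp⟩
  | mul x y _ _ hx hy =>
    obtain ⟨α, rfl, hα⟩ := hx
    obtain ⟨β, rfl, hβ⟩ := hy
    exact ⟨α ++ β, wordProd_append .., by grind⟩
  | inv x _ hx =>
    obtain ⟨α, rfl, hα⟩ := hx
    exact ⟨α.reverse, by simp, by simpa using hα⟩

lemma wordProd_mem_closure {S : Set B} {ω : List B} (h : ∀ i ∈ ω, i ∈ S) :
    cs.wordProd ω ∈ Subgroup.closure (cs.simple '' S) := by
  rw [wordProd]
  refine Subgroup.list_prod_mem _ fun x hx => ?_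
  obtain ⟨i, hi, rfl⟩ := List.mem_map.mp hx
  exact Subgroup.subset_closure ⟨i, h i hi, rfl⟩

end Subwords

end CoxeterSystem

namespace BSM

open CoxeterSystem

variable {B : Type*} {W : Type*} [Group W] {M : CoxeterMatrix B} {cs : CoxeterSystem M W}
  (φ : BSM cs)

/-- Elements of the domain not above `φ 1` are matched upwards, and `φ` is monotone below them. -/
lemma bCov_and_monotone_of_not_le :
    ∀ u ∈ φ.dom, ¬ bruhatLE cs (φ.toFun 1) u →
      bCov cs u (φ.toFun u) ∧ ∀ v, bruhatLE cs v u → bruhatLE cs (φ.toFun v) (φ.toFun u) := by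
  suffices ∀ n, ∀ u ∈ φ.dom, cs.length u = n → ¬ bruhatLE cs (φ.toFun 1) u →
      bCov cs u (φ.toFun u) ∧ ∀ v, bruhatLE cs v u → bruhatLE cs (φ.toFun v) (φ.toFun u) from
    fun u hu => this _ u hu rfl
  intro n
  induction n using Nat.strong_induction_on with
  | _ n ih =>
  intro u hu hn ha
  have hone : ∀ x : W, bruhatLE cs 1 x := fun x => by
    obtain ⟨ω, hω, rfl⟩ := cs.exists_isReduced x
    simpa using cs.bruhatLE_of_sublist (List.nil_sublist ω) hω
  have hup : bCov cs u (φ.toFun u) := by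
    refine (φ.cov u hu).resolve_left fun hc => ?_
    have hl := length_of_bCov hc
    have := (ih _ (by omega) _ (φ.maps u hu) rfl fun h => ha (h.trans hc.1)).2 1 (hone _)
    rw [φ.invol u hu] at this
    exact ha this
  refine ⟨hup, fun v hv => ?_⟩
  by_cases hvu : v = u
  · rw [hvu]; exact .refl
  obtain ⟨x, hvx, hxu⟩ := exists_coatom_of_bruhatLE hv hvu
  have hl := length_of_bCov hxu
  obtain ⟨hx1, hx2⟩ :=
    ih _ (by omega) x (φ.ideal hu hxu.1) rfl fun h => ha (h.trans hxu.1)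
  have : φ.toFun x ∈ bCoat cs (φ.toFun u) := by
    rw [φ.coatom u hu hup]; exact Or.inr ⟨x, hxu, hx1, rfl⟩
  exact (hx2 v hvx).trans this.1

variable {φ} {a : B}

lemma bCov_of_not_le (ha : φ.toFun 1 = cs.simple a) {u : W}
    (hu : u ∈ φ.dom) (hau : ¬ bruhatLE cs (cs.simple a) u) : bCov cs u (φ.toFun u) :=
  (φ.bCov_and_monotone_of_not_le u hu (by rwa [ha])).1

lemma apply_le_apply_of_not_le (ha : φ.toFun 1 = cs.simple a) {u v : W}
    (hu : u ∈ φ.dom) (hau : ¬ bruhatLE cs (cs.simple a) u) (h : bruhatLE cs v u) :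
    bruhatLE cs (φ.toFun v) (φ.toFun u) :=
  (φ.bCov_and_monotone_of_not_le u hu (by rwa [ha])).2 v h

/-- An element of the domain not above `a` is matched by inserting the letter `a`. -/
lemma exists_insertion (ha : φ.toFun 1 = cs.simple a) {u : W}
    (hu : u ∈ φ.dom) (hau : ¬ bruhatLE cs (cs.simple a) u) :
    ∃ α b β, cs.simple b = cs.simple a ∧ φ.toFun u = cs.wordProd (α ++ b :: β) ∧
      u = cs.wordProd (α ++ β) ∧ cs.IsReduced (α ++ β) := by
  have hc := bCov_of_not_le ha hu hau
  obtain ⟨ω, hω, he⟩ := cs.exists_isReduced (φ.toFun u)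
  rw [he] at hc
  obtain ⟨α, b, β, rfl, h3, h4⟩ := cs.exists_deletion_of_bCov hω hc
  refine ⟨α, b, β, ?_, he, h3, h4⟩
  have h5 : bruhatLE cs (φ.toFun 1) (φ.toFun u) := by
    refine apply_le_apply_of_not_le ha hu hau ?_
    rw [h3]; simpa using cs.bruhatLE_of_sublist (List.nil_sublist _) h4
  rw [ha, he] at h5
  obtain ⟨j, hj, hja⟩ := cs.exists_mem_of_simple_bruhatLE h5
  have hj' : j ∉ α ++ β := fun h => hau (by
    rw [← hja, h3]; exact cs.simple_bruhatLE_of_mem h4 h)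
  have : j = b := by grind
  rw [← this, hja]

lemma apply_simple_self (h1 : (1 : W) ∈ φ.dom) (ha : φ.toFun 1 = cs.simple a) :
    φ.toFun (cs.simple a) = 1 := by
  rw [← ha, φ.invol 1 h1]

lemma not_simple_le_of_ne {i : B} (h : cs.simple i ≠ cs.simple a) :
    ¬ bruhatLE cs (cs.simple a) (cs.simple i) := by
  rw [← cs.wordProd_singleton i]
  intro hle
  obtain ⟨j, hj, he⟩ := cs.exists_mem_of_simple_bruhatLE hle
  simp only [List.mem_singleton] at hj
  exact h (hj ▸ he)

lemma apply_simple_eq_or (h1 : (1 : W) ∈ φ.dom) (ha : φ.toFun 1 = cs.simple a) {i : B}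
    (hi : cs.simple i ∈ φ.dom) :
    φ.toFun (cs.simple i) = cs.simple i * cs.simple a ∨
      φ.toFun (cs.simple i) = cs.simple a * cs.simple i := by
  by_cases hia : cs.simple i = cs.simple a
  · left; rw [hia, apply_simple_self h1 ha]; simp
  obtain ⟨α, b, β, hb, he, hi', hr⟩ := exists_insertion ha hi (not_simple_le_of_ne hia)
  have hl := hr.eq
  rw [← hi', cs.length_simple, List.length_append] at hl
  rw [he, wordProd_append, wordProd_cons, hb]
  cases α with
  | nil => right; simp at hi'; simp [← hi']
  | cons x α =>
    obtain rfl : β = [] := List.eq_nil_of_length_eq_zero (by simp at hl; omega)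
    left
    rw [List.append_nil] at hi'
    simp [← hi']

variable (φ) (a) in
/-- The letters `g` with `φ g = g a`. -/
abbrev rightLetters : Set B := {i | φ.toFun (cs.simple i) = cs.simple i * cs.simple a}

variable (φ) (a) in
/-- The letters `d` with `φ d = a d`. -/
abbrev leftLetters : Set B := {i | φ.toFun (cs.simple i) = cs.simple a * cs.simple i}

lemma self_mem_rightLetters (h1 : (1 : W) ∈ φ.dom) (ha : φ.toFun 1 = cs.simple a) {i : B}
    (hi : cs.simple i = cs.simple a) : i ∈ φ.rightLetters a := by
  simp [hi, apply_simple_self h1 ha]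

lemma self_mem_leftLetters (h1 : (1 : W) ∈ φ.dom) (ha : φ.toFun 1 = cs.simple a) {i : B}
    (hi : cs.simple i = cs.simple a) : i ∈ φ.leftLetters a := by
  simp [hi, apply_simple_self h1 ha]

/-- If `w = t z s` with `t` a left letter only, `s` a right letter only, the letters of `z` both,
and `w` is not above `a`, then `w` is a product of right letters followed by left letters. -/
lemma exists_split (h1 : (1 : W) ∈ φ.dom) (ha : φ.toFun 1 = cs.simple a) {t s : B} {ζ : List B}
    (hr : cs.IsReduced (t :: ζ ++ [s])) (hw : cs.wordProd (t :: ζ ++ [s]) ∈ φ.dom)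
    (htD : t ∈ φ.leftLetters a) (htG : t ∉ φ.rightLetters a)
    (hsG : s ∈ φ.rightLetters a) (hsD : s ∉ φ.leftLetters a)
    (hζG : ∀ i ∈ ζ, i ∈ φ.rightLetters a) (hζD : ∀ i ∈ ζ, i ∈ φ.leftLetters a)
    (hζa : ∀ i ∈ ζ, cs.simple i ≠ cs.simple a) :
    ∃ α β, (∀ i ∈ α, i ∈ φ.rightLetters a) ∧ (∀ i ∈ β, i ∈ φ.leftLetters a) ∧
      cs.wordProd (t :: ζ ++ [s]) = cs.wordProd (α ++ β) := by
  classical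
  have hta : cs.simple t ≠ cs.simple a := fun h => htG (self_mem_rightLetters h1 ha h)
  have hsa : cs.simple s ≠ cs.simple a := fun h => hsD (self_mem_leftLetters h1 ha h)
  have haw : ¬ bruhatLE cs (cs.simple a) (cs.wordProd (t :: ζ ++ [s])) := fun h => by
    obtain ⟨j, hj, he⟩ := cs.exists_mem_of_simple_bruhatLE h
    simp only [List.cons_append, List.mem_cons, List.mem_append, List.not_mem_nil, or_false] at hj
    rcases hj with rfl | hj | rfl
    exacts [hta he, hζa _ hj he, hsa he]
  obtain ⟨α, b, β, -, he, hw', hr'⟩ := exists_insertion ha hw haw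
  have hge : ∀ j ∈ t :: ζ ++ [s],
      bruhatLE cs (φ.toFun (cs.simple j)) (cs.wordProd (α ++ b :: β)) := fun j hj => by
    rw [← he]
    exact apply_le_apply_of_not_le ha hw haw (cs.simple_bruhatLE_of_mem hr hj)
  have hnot_a : ∀ j ∈ α ++ β, cs.simple j ≠ cs.simple a := fun j hj h => haw (by
    rw [← h, hw']; exact cs.simple_bruhatLE_of_mem hr' hj)
  have htβ : ∃ y ∈ β, cs.simple y = cs.simple t := by
    have h := hge t (by simp)
    rw [htD] at h
    obtain ⟨x, y, hxy, hx, hy⟩ :=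
      cs.exists_pair_sublist (fun h' => htG (htD.trans h')) h
    exact ⟨y, hxy.mem_right_of_pair fun h => hnot_a x (by simp [h]) hx, hy⟩
  have hsα : ∃ x ∈ α, cs.simple x = cs.simple s := by
    have h := hge s (by simp)
    rw [hsG] at h
    obtain ⟨x, y, hxy, hx, hy⟩ :=
      cs.exists_pair_sublist (fun h' => hsD (hsG.trans h')) h
    exact ⟨x, hxy.mem_left_of_pair fun h => hnot_a y (by simp [h]) hy, hx⟩
  have htα : ∀ x ∈ α, cs.simple x ≠ cs.simple t := by
    have hc := cs.countP_le_one_of_cons (γ := ζ ++ [s]) hr' (by simpa using hr)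
      (by rw [← hw']; simp) (by
        intro j hj hjt
        rcases List.mem_append.mp hj with hj | hj
        · have := hζG j hj
          exact htG (by simpa [rightLetters, hjt] using this)
        · rw [List.mem_singleton] at hj
          subst hj
          exact htG (by simpa [rightLetters, hjt] using hsG))
    intro x hx hxt
    obtain ⟨y, hy, hyt⟩ := htβ
    have hα : 0 < α.countP (fun j => cs.simple j = cs.simple t) :=
      List.countP_pos_iff.mpr ⟨x, hx, by simpa using hxt⟩
    have hβ : 0 < β.countP (fun j => cs.simple j = cs.simple t) :=
      List.countP_pos_iff.mpr ⟨y, hy, by simpa using hyt⟩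
    rw [List.countP_append] at hc
    omega
  have hsβ : ∀ x ∈ β, cs.simple x ≠ cs.simple s := by
    have hc := cs.countP_le_one_of_concat (γ := t :: ζ) hr' hr hw'.symm (by
        intro j hj hjs
        rcases List.mem_cons.mp hj with hj | hj
        · subst hj
          exact hsD (by simpa [leftLetters, hjs] using htD)
        · have := hζD j hj
          exact hsD (by simpa [leftLetters, hjs] using this))
    intro x hx hxs
    obtain ⟨y, hy, hys⟩ := hsα
    have hβ : 0 < β.countP (fun j => cs.simple j = cs.simple s) :=
      List.countP_pos_iff.mpr ⟨x, hx, by simpa using hxs⟩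
    have hα : 0 < α.countP (fun j => cs.simple j = cs.simple s) :=
      List.countP_pos_iff.mpr ⟨y, hy, by simpa using hys⟩
    rw [List.countP_append] at hc
    omega
  have hG := cs.forall_letters_of_eq hr' hw'.symm
    (P := fun w => w = cs.simple t ∨ φ.toFun w = w * cs.simple a) (by
      intro j hj
      simp only [List.cons_append, List.mem_cons, List.mem_append, List.not_mem_nil,
        or_false] at hj
      rcases hj with rfl | hj | rfl
      exacts [Or.inl rfl, Or.inr (hζG _ hj), Or.inr hsG])
  have hD := cs.forall_letters_of_eq hr' hw'.symm
    (P := fun w => w = cs.simple s ∨ φ.toFun w = cs.simple a * w) (by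
      intro j hj
      simp only [List.cons_append, List.mem_cons, List.mem_append, List.not_mem_nil,
        or_false] at hj
      rcases hj with rfl | hj | rfl
      exacts [Or.inr htD, Or.inr (hζD _ hj), Or.inl rfl])
  refine ⟨α, β, fun i hi => (hG i (by simp [hi])).resolve_left (htα i hi),
    fun i hi => (hD i (by simp [hi])).resolve_left (hsβ i hi), hw'⟩

/-- The obstruction to a left letter preceding `a` and a right letter. -/
lemma simple_mul_mul_not_mem_dom (h1 : (1 : W) ∈ φ.dom) (ha : φ.toFun 1 = cs.simple a) {t s : B}
    (htD : t ∈ φ.leftLetters a) (htG : t ∉ φ.rightLetters a)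
    (hsG : s ∈ φ.rightLetters a) (hsD : s ∉ φ.leftLetters a)
    (hts : cs.wordProd [t, s] ∈ φ.dom) : cs.wordProd [t, a, s] ∉ φ.dom := by
  intro htas
  have hta : cs.simple t ≠ cs.simple a := fun h => htG (self_mem_rightLetters h1 ha h)
  have hsa : cs.simple s ≠ cs.simple a := fun h => hsD (self_mem_leftLetters h1 ha h)
  have hne : cs.simple t ≠ cs.simple s := fun h => by
    rw [Set.mem_ofPred_eq, h] at htD
    exact hsD htD
  have hat : cs.simple a * cs.simple t ≠ cs.simple t * cs.simple a :=
    fun h => htG (htD.trans h)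
  have has : cs.simple s * cs.simple a ≠ cs.simple a * cs.simple s :=
    fun h => hsD (hsG.trans h)
  have hr2 := cs.isReduced_pair hne
  have hau : ¬ bruhatLE cs (cs.simple a) (cs.wordProd [t, s]) := fun h => by
    obtain ⟨j, hj, he⟩ := cs.exists_mem_of_simple_bruhatLE h
    grind
  have hr3 : cs.IsReduced [t, a, s] := by
    have hl2 := (cs.isReduced_pair hta).eq
    rcases cs.length_mul_simple (cs.wordProd [t, a]) s with h | h
    · rw [hl2] at h
      simpa [CoxeterSystem.IsReduced, wordProd_cons, mul_assoc] using h
    · rw [hl2] at h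
      obtain ⟨ω, hω, he⟩ := cs.exists_isReduced (cs.wordProd [t, a] * cs.simple s)
      have hl := hω.eq
      rw [← he] at hl
      obtain ⟨x, rfl⟩ := List.length_eq_one_iff.mp
        (show ω.length = 1 by simp at h; omega)
      have := cs.forall_letters_of_eq (γ := [x, s]) (cs.isReduced_pair hta)
        (P := fun w => w = cs.simple x ∨ w = cs.simple s)
        (by
          rw [← mul_inv_eq_iff_eq_mul.symm.mp he.symm]
          simp [wordProd_cons]) (by simp)
      grind
  have hle_ta : bruhatLE cs (cs.simple t * cs.simple a) (cs.wordProd [t, a, s]) := by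
    simpa [wordProd_cons] using cs.bruhatLE_of_sublist (ω' := [t, a]) (by simp) hr3
  have hle_as : bruhatLE cs (cs.simple a * cs.simple s) (cs.wordProd [t, a, s]) := by
    simpa [wordProd_cons] using cs.bruhatLE_of_sublist (ω' := [a, s]) (by simp) hr3
  have hle_at : bruhatLE cs (cs.simple a * cs.simple t) (φ.toFun (cs.wordProd [t, s])) := by
    rw [← htD]
    exact apply_le_apply_of_not_le ha hts hau (cs.simple_bruhatLE_of_mem hr2 (by simp))
  have hle_sa : bruhatLE cs (cs.simple s * cs.simple a) (φ.toFun (cs.wordProd [t, s])) := by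
    rw [← hsG]
    exact apply_le_apply_of_not_le ha hts hau (cs.simple_bruhatLE_of_mem hr2 (by simp))
  have hne3 : φ.toFun (cs.wordProd [t, s]) ≠ cs.wordProd [t, a, s] := fun h => by
    rw [h] at hle_at
    obtain ⟨x, y, hxy, hx, hy⟩ := cs.exists_pair_sublist hat hle_at
    have := hxy.eq_or_of_pair_of_triple
    grind
  have hup2 := bCov_of_not_le ha hts hau
  have hcov : bCov cs (cs.wordProd [t, s]) (cs.wordProd [t, a, s]) :=
    bCov_of_length (cs.bruhatLE_of_sublist (by simp) hr3) (by rw [hr2.eq, hr3.eq]; rfl)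
  have hup3 : bCov cs (cs.wordProd [t, a, s]) (φ.toFun (cs.wordProd [t, a, s])) := by
    refine (φ.cov _ htas).resolve_left fun hc => ?_
    have hmem : cs.wordProd [t, s] ∈ bCoat cs (cs.wordProd [t, a, s]) := hcov
    have hco := φ.coatom _ (φ.maps _ htas) (by rwa [φ.invol _ htas])
    rw [φ.invol _ htas] at hco
    rw [hco] at hmem
    rcases hmem with h | ⟨v, hv1, hv2, hv3⟩
    · exact hne3 (by rw [Set.mem_singleton_iff.mp h, φ.invol _ htas])
    · have hvd := φ.ideal (φ.maps _ htas) hv1.1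
      have hl1 := length_of_bCov hup2
      have hl2 := length_of_bCov hv2
      rw [hv3, φ.invol _ hvd] at hl1
      omega
  have hcov' : bCov cs (φ.toFun (cs.wordProd [t, s])) (φ.toFun (cs.wordProd [t, a, s])) := by
    have : φ.toFun (cs.wordProd [t, s]) ∈ bCoat cs (φ.toFun (cs.wordProd [t, a, s])) := by
      rw [φ.coatom _ htas hup3]
      exact Or.inr ⟨_, hcov, hup2, rfl⟩
    exact this
  have hl4 := length_of_bCov hup3
  obtain ⟨ω, hω, he⟩ := cs.exists_isReduced (φ.toFun (cs.wordProd [t, a, s]))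
  rw [he] at hup3 hcov' hl4
  rw [hω.eq, hr3.eq] at hl4
  have key : ∀ {u : W} {p q : B}, bCov cs u (cs.wordProd ω) →
      bruhatLE cs (cs.simple p * cs.simple a) u → bruhatLE cs (cs.simple a * cs.simple q) u →
      cs.simple p * cs.simple a ≠ cs.simple a * cs.simple p →
      cs.simple a * cs.simple q ≠ cs.simple q * cs.simple a → cs.simple p ≠ cs.simple q →
      [cs.simple p, cs.simple a, cs.simple q].Sublist (ω.map cs.simple) := by
    intro u p q hu hpa haq hcp hcq hpq
    obtain ⟨γ, hγω, hγ, rfl⟩ := cs.exists_sublist_of_bruhatLE hu.1 ω rfl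
    have hl := length_of_bCov hu
    rw [hω.eq, hγ.eq, hl4] at hl
    obtain ⟨x, y, z, rfl⟩ := List.length_eq_three.mp (show γ.length = 3 by simpa using hl.symm)
    obtain ⟨x₁, y₁, h₁, hx₁, hy₁⟩ := cs.exists_pair_sublist hcp hpa
    obtain ⟨x₂, y₂, h₂, hx₂, hy₂⟩ := cs.exists_pair_sublist hcq haq
    have hpa' : cs.simple p ≠ cs.simple a := fun h => hcp (by rw [h])
    have hqa' : cs.simple q ≠ cs.simple a := fun h => hcq (by rw [h])
    have e₁ := h₁.eq_or_of_pair_of_triple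
    have e₂ := h₂.eq_or_of_pair_of_triple
    have := hγω.map cs.simple
    have hxyz : cs.simple x = cs.simple p ∧ cs.simple y = cs.simple a ∧
        cs.simple z = cs.simple q := by grind
    simpa [hxyz] using this
  exact (key hup3 hle_ta hle_as hat.symm has.symm hne).false_of_triple_of_reverse
    (key hcov' hle_sa hle_at has hat hne.symm) (by simpa using hl4) hta hsa.symm hne

/-- An element of `⟨G⟩⟨D⟩` has a reduced word made of a word in `G` followed by a word in `D`. -/
lemma exists_isReduced_append {G D : Set B} {g d : W}
    (hg : g ∈ Subgroup.closure (cs.simple '' G)) (hd : d ∈ Subgroup.closure (cs.simple '' D)) :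
    ∃ α β, cs.IsReduced (α ++ β) ∧ g * d = cs.wordProd (α ++ β) ∧
      (∀ i ∈ α, i ∈ G) ∧ ∀ i ∈ β, i ∈ D := by
  obtain ⟨α, -, rfl, hα⟩ := cs.exists_word_of_mem_closure hg
  obtain ⟨β, -, rfl, hβ⟩ := cs.exists_word_of_mem_closure hd
  obtain ⟨ω, hs, hr, he⟩ := cs.exists_isReduced_sublist (α ++ β)
  obtain ⟨α', β', rfl, hα', hβ'⟩ := List.sublist_append_iff.mp hs
  exact ⟨α', β', hr, by rw [he, wordProd_append], fun i hi => hα i (hα'.subset hi),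
    fun i hi => hβ i (hβ'.subset hi)⟩

lemma exists_eq_mul_of_mem_dom (h1 : (1 : W) ∈ φ.dom) (ha : φ.toFun 1 = cs.simple a) {w : W}
    (hw : w ∈ φ.dom) :
    ∃ g ∈ Subgroup.closure (cs.simple '' φ.rightLetters a),
      ∃ d ∈ Subgroup.closure (cs.simple '' φ.leftLetters a), w = g * d := by
  induction hn : cs.length w using Nat.strong_induction_on generalizing w with
  | _ n ih =>
  subst hn
  by_contra hwP
  have hleft : ∀ x y, y ∈ φ.dom → cs.length y < cs.length w →
      x ∈ Subgroup.closure (cs.simple '' φ.rightLetters a) → w ≠ x * y := by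
    rintro x y hy hl hx rfl
    obtain ⟨g, hg, d, hd, rfl⟩ := ih _ hl hy rfl
    exact hwP ⟨x * g, mul_mem hx hg, d, hd, (mul_assoc _ _ _).symm⟩
  have hright : ∀ x y, y ∈ φ.dom → cs.length y < cs.length w →
      x ∈ Subgroup.closure (cs.simple '' φ.leftLetters a) → w ≠ y * x := by
    rintro x y hy hl hx rfl
    obtain ⟨g, hg, d, hd, rfl⟩ := ih _ hl hy rfl
    exact hwP ⟨g, hg, d * x, mul_mem hd hx, mul_assoc _ _ _⟩
  have hsub : ∀ {ω γ : List B}, γ.Sublist ω → cs.IsReduced ω → cs.wordProd ω = w →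
      cs.wordProd γ ∈ φ.dom := fun h hr he =>
    φ.ideal hw (he ▸ cs.bruhatLE_of_sublist h hr)
  have hmem : ∀ {S : Set B} {i : B}, i ∈ S →
      cs.simple i ∈ Subgroup.closure (cs.simple '' S) :=
    fun h => Subgroup.subset_closure ⟨_, h, rfl⟩
  have hfirst : ∀ {t : B} {ω : List B}, cs.IsReduced (t :: ω) → cs.wordProd (t :: ω) = w →
      t ∈ φ.leftLetters a ∧ t ∉ φ.rightLetters a := by
    intro t ω hr he
    have htG : t ∉ φ.rightLetters a := fun h =>
      hleft (cs.simple t) (cs.wordProd ω) (hsub (List.sublist_cons_self t ω) hr he)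
        (by rw [← he, hr.eq, hr.of_cons.eq]; simp) (hmem h) (by rw [← he, wordProd_cons])
    refine ⟨(apply_simple_eq_or h1 ha ?_).resolve_left htG, htG⟩
    simpa using hsub (γ := [t]) (by simp) hr he
  have hlast : ∀ {s : B} {ω : List B}, cs.IsReduced (ω ++ [s]) → cs.wordProd (ω ++ [s]) = w →
      s ∈ φ.rightLetters a ∧ s ∉ φ.leftLetters a := by
    intro s ω hr he
    have hsD : s ∉ φ.leftLetters a := fun h =>
      hright (cs.simple s) (cs.wordProd ω) (hsub (List.sublist_append_left ω [s]) hr he)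
        (by rw [← he, hr.eq, (hr.of_append).1.eq]; simp) (hmem h)
        (by rw [← he, wordProd_append, wordProd_singleton])
    refine ⟨(apply_simple_eq_or h1 ha ?_).resolve_right hsD, hsD⟩
    simpa using hsub (γ := [s]) (by simp) hr he
  obtain ⟨ω, hω, hωw⟩ := cs.exists_isReduced w
  rcases ω with _ | ⟨t, ω⟩
  · exact hwP ⟨1, one_mem _, 1, one_mem _, by simpa using hωw⟩
  obtain ⟨htD, htG⟩ := hfirst hω hωw.symm
  obtain ⟨g, hg, d, hd, he⟩ := ih (cs.length (cs.wordProd ω))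
    (by rw [hωw, hω.eq, hω.of_cons.eq]; simp)
    (hsub (List.sublist_cons_self t ω) hω hωw.symm) rfl
  obtain ⟨γ, δ, hr, he', hγ, hδ⟩ := exists_isReduced_append hg hd
  have hr' : cs.IsReduced (t :: (γ ++ δ)) := by
    have := hω.eq
    have h2 := hω.of_cons.eq
    rw [he, he', hr.eq] at h2
    rw [CoxeterSystem.IsReduced, wordProd_cons, ← he', ← he, ← wordProd_cons, this]
    simp [h2]
  have hw' : cs.wordProd (t :: (γ ++ δ)) = w := by
    rw [hωw, wordProd_cons, wordProd_cons, he, he']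
  rcases δ.eq_nil_or_concat with rfl | ⟨δ, r, rfl⟩
  swap
  · simp only [List.concat_eq_append, ← List.append_assoc, ← List.cons_append] at hr' hw'
    exact (hlast hr' hw').2 (hδ r (by simp))
  rw [List.append_nil] at hr' hw'
  rcases γ.eq_nil_or_concat with rfl | ⟨ζ, s, rfl⟩
  · exact hwP ⟨1, one_mem _, cs.simple t, hmem htD, by simp [← hw']⟩
  rw [List.concat_eq_append] at hr' hw' hγ
  rw [← List.cons_append] at hr' hw'
  obtain ⟨hsG, hsD⟩ := hlast hr' hw'
  have hζG : ∀ i ∈ ζ, i ∈ φ.rightLetters a := fun i hi => hγ i (by simp [hi])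
  have hr₁ := (hr'.of_append).1
  have hl₁ : cs.length (cs.wordProd (t :: ζ)) < cs.length w := by
    rw [← hw', hr'.eq, hr₁.eq]; simp
  have hζD : ∀ i ∈ ζ, i ∈ φ.leftLetters a := by
    obtain ⟨g, hg, d, hd, he⟩ := ih _ hl₁ (hsub (List.sublist_append_left _ [s]) hr' hw') rfl
    obtain ⟨α, β, hr₂, he₂, hα, hβ⟩ := exists_isReduced_append hg hd
    have he₃ := he.trans he₂
    cases α with
    | nil =>
      have := cs.forall_letters_of_eq hr₁ he₃
        (P := fun w => φ.toFun w = cs.simple a * w) (fun j hj => hβ j hj)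
      exact fun i hi => this i (List.mem_cons_of_mem _ hi)
    | cons i α =>
      have hl := hr₂.eq
      have hw₃ : cs.wordProd (i :: α ++ β ++ [s]) = w := by
        rw [wordProd_append, ← he₃, ← wordProd_append, hw']
      refine absurd (hα i (by simp)) (hfirst (ω := α ++ β ++ [s]) ?_ hw₃).2
      rw [← he₃, hr₁.eq] at hl
      have := hr'.eq
      rw [hw', ← hw₃] at this
      rw [CoxeterSystem.IsReduced]
      simp at this hl ⊢
      omega
  by_cases hζa : ∃ i ∈ ζ, cs.simple i = cs.simple a
  · obtain ⟨i, hi, hia⟩ := hζa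
    have hts : cs.wordProd [t, s] ∈ φ.dom := hsub (by simp) hr' hw'
    refine simple_mul_mul_not_mem_dom h1 ha htD htG hsG hsD hts ?_
    have : cs.wordProd [t, i, s] ∈ φ.dom := by
      refine hsub ?_ hr' hw'
      exact ((List.singleton_sublist.mpr hi).append_right [s]).cons_cons t
    simpa [wordProd_cons, hia] using this
  · push Not at hζa
    obtain ⟨α, β, hα, hβ, he⟩ :=
      exists_split h1 ha hr' (hw' ▸ hw) htD htG hsG hsD hζG hζD hζa
    exact hwP ⟨_, cs.wordProd_mem_closure hα, _, cs.wordProd_mem_closure hβ, by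
      rw [← hw', he, wordProd_append]⟩

end BSM

/-- with `G = {g ∈ S : φ(g) = ga}` and `D = {d ∈ S : φ(d) = ad}`, the
domain of a maximal partial special matching is contained in `⟨G⟩⟨D⟩`. -/
theorem stmt14 {B : Type*} {W : Type*} [Group W] {M : CoxeterMatrix B}
    (cs : CoxeterSystem M W) (φ : BSM cs) (hmax : BMax φ)
    (h1 : (1 : W) ∈ φ.dom) (a : B) (ha : φ.toFun 1 = cs.simple a) :
    ∀ w ∈ φ.dom,
      ∃ g ∈ (Subgroup.closure
          (cs.simple '' {i : B | φ.toFun (cs.simple i) = cs.simple i * cs.simple a}) :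
          Subgroup W),
        ∃ d ∈ (Subgroup.closure
          (cs.simple '' {i : B | φ.toFun (cs.simple i) = cs.simple a * cs.simple i}) :
          Subgroup W),
          w = g * d :=
  fun _ hw => BSM.exists_eq_mul_of_mem_dom h1 ha hw
end
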